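/- Let d ≥ 1 and let G be a nontrivial finite group acting continuously and freely on the unit sphere subtype ↥(Metric.sphere (0 : EuclideanSpace ℝ (Fin (d+1))) 1) and acting continuously and freely on S^{d+1}. Let f : EuclideanSpace ℝ (Fin (d+1)) → S^{d+1} be continuous on the closed unit ball Metric.closedBall 0 1 and equivariant on the boundary sphere, i.e. f(↑(g • x)) = g • f(↑x) for every g ∈ G and every point x of the unit sphere subtype of EuclideanSpace ℝ (Fin (d+1)). Then the image of the closed unit ball under f meets every G-orbit in S^{d+1}: for every y ∈ S^{d+1} there exist g ∈ G and x ∈ Metric.closedBall 0 1 with f(x) = g • y. -/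

import Mathlib

set_option linter.unusedSectionVars false

open Set Topology

/-! ### Chains on lists -/

/-- Finite formal combinations of lists of points; a list of length `k` is an ordered simplex
of dimension `k - 1`. -/
abbrev ListChain (R α : Type*) [CommRing R] := List α →₀ R

namespace ListChain

section Basic

variable {R α β γ : Type*} [CommRing R]

/-- Prefixing every simplex with the vertex `a`. -/
noncomputable def cone (a : α) : ListChain R α →ₗ[R] ListChain R α :=
  Finsupp.lmapDomain R R (List.cons a)

/-- The chain map induced by a map of vertices. -/
noncomputable def map (f : α → β) : ListChain R α →ₗ[R] ListChain R β :=
  Finsupp.lmapDomain R R (List.map f)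

/-- The boundary of a single simplex. -/
noncomputable def bdList (R : Type*) [CommRing R] : List α → ListChain R α
  | [] => 0
  | a :: l => Finsupp.single l 1 - cone a (bdList R l)

/-- The (augmented) simplicial boundary. -/
noncomputable def bd : ListChain R α →ₗ[R] ListChain R α :=
  Finsupp.linearCombination R (bdList R)

@[simp] lemma cone_single (a : α) (l : List α) (r : R) :
    cone a (Finsupp.single l r) = Finsupp.single (a :: l) r := by
  simp [cone]

@[simp] lemma map_single (f : α → β) (l : List α) (r : R) :
    map f (Finsupp.single l r) = Finsupp.single (l.map f) r := by
  simp [map]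

@[simp] lemma bd_single_nil (r : R) : bd (Finsupp.single ([] : List α) r) = 0 := by
  simp [bd, bdList]

lemma bd_single_one (l : List α) : bd (Finsupp.single l (1 : R)) = bdList R l := by
  simp [bd]

lemma linearMap_ext {M : Type*} [AddCommGroup M] [Module R M] {φ ψ : ListChain R α →ₗ[R] M}
    (h : ∀ l, φ (Finsupp.single l 1) = ψ (Finsupp.single l 1)) : φ = ψ :=
  Finsupp.lhom_ext' fun l => LinearMap.ext_ring (h l)

lemma bd_cone (a : α) (c : ListChain R α) : bd (cone a c) = c - cone a (bd c) := by
  suffices (bd ∘ₗ cone a : ListChain R α →ₗ[R] _) = LinearMap.id - cone a ∘ₗ bd from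
    LinearMap.congr_fun this c
  refine linearMap_ext fun l => ?_
  simp [bd_single_one, bdList]

lemma map_cone (f : α → β) (a : α) (c : ListChain R α) :
    map f (cone a c) = cone (f a) (map f c) := by
  suffices (map f ∘ₗ cone a : ListChain R α →ₗ[R] _) = cone (f a) ∘ₗ map f from
    LinearMap.congr_fun this c
  refine linearMap_ext fun l => ?_
  simp

lemma bd_map (f : α → β) (c : ListChain R α) : bd (map f c) = map f (bd c) := by
  suffices (bd ∘ₗ map f : ListChain R α →ₗ[R] _) = map f ∘ₗ bd from LinearMap.congr_fun this c
  refine linearMap_ext fun l => ?_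
  simp only [LinearMap.comp_apply, map_single, bd_single_one]
  induction l with
  | nil => simp [bdList]
  | cons a l ih => simp [bdList, ih, map_cone]

lemma bd_bd (c : ListChain R α) : bd (bd c) = 0 := by
  suffices (bd ∘ₗ bd : ListChain R α →ₗ[R] _) = 0 from LinearMap.congr_fun this c
  refine linearMap_ext fun l => ?_
  simp only [LinearMap.comp_apply, bd_single_one, LinearMap.zero_apply]
  induction l with
  | nil => simp [bdList]
  | cons a l ih => simp [bdList, bd_cone, ih, bd_single_one]

lemma map_map (f : α → β) (h : β → γ) (c : ListChain R α) :
    map h (map f c) = map (h ∘ f) c := by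
  suffices (map h ∘ₗ map f : ListChain R α →ₗ[R] _) = map (h ∘ f) from LinearMap.congr_fun this c
  refine linearMap_ext fun l => ?_
  simp

lemma map_id (c : ListChain R α) : map id c = c := by
  suffices (map id : ListChain R α →ₗ[R] _) = LinearMap.id from LinearMap.congr_fun this c
  refine linearMap_ext fun l => ?_
  simp

/-- The chains all of whose simplices lie in `s`. -/
abbrev on (R : Type*) [CommRing R] (s : Set (List α)) : Submodule R (ListChain R α) :=
  Finsupp.supported R R s

lemma single_mem_on {s : Set (List α)} {l : List α} (h : l ∈ s) (r : R) :
    Finsupp.single l r ∈ on R s :=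
  Finsupp.single_mem_supported R r h

lemma apply_mem_of_forall {M : Type*} [AddCommGroup M] [Module R M] (φ : ListChain R α →ₗ[R] M)
    {s : Set (List α)} {p : Submodule R M} (h : ∀ l ∈ s, φ (Finsupp.single l 1) ∈ p)
    {c : ListChain R α} (hc : c ∈ on R s) : φ c ∈ p := by
  rw [on, Finsupp.supported_eq_span_single] at hc
  suffices Submodule.span R ((fun i => Finsupp.single i (1 : R)) '' s) ≤ p.comap φ from this hc
  rw [Submodule.span_le]
  rintro _ ⟨l, hl, rfl⟩
  exact h l hl

lemma cone_mem_on {s t : Set (List α)} {a : α} (h : ∀ l ∈ s, a :: l ∈ t) {c : ListChain R α}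
    (hc : c ∈ on R s) : cone a c ∈ on R t :=
  apply_mem_of_forall _ (fun l hl => by simpa using single_mem_on (h l hl) 1) hc

lemma map_mem_on {s : Set (List α)} {t : Set (List β)} {f : α → β} (h : ∀ l ∈ s, l.map f ∈ t)
    {c : ListChain R α} (hc : c ∈ on R s) : map f c ∈ on R t :=
  apply_mem_of_forall _ (fun l hl => by simpa using single_mem_on (h l hl) 1) hc

lemma bdList_mem_on (l : List α) :
    bdList R l ∈ on R {l' | l'.Sublist l ∧ l'.length + 1 = l.length} := by
  induction l with
  | nil => simp [bdList]
  | cons a l ih =>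
    refine sub_mem (single_mem_on (by simp) 1) (cone_mem_on ?_ ih)
    rintro l' ⟨h, h'⟩
    exact ⟨h.cons_cons a, by simp [h']⟩

lemma bd_mem_on {s t : Set (List α)}
    (h : ∀ l ∈ s, ∀ l', l'.Sublist l → l'.length + 1 = l.length → l' ∈ t) {c : ListChain R α}
    (hc : c ∈ on R s) : bd c ∈ on R t := by
  refine apply_mem_of_forall _ (fun l hl => ?_) hc
  rw [bd_single_one]
  exact Finsupp.supported_mono (fun l' hl' => h l hl l' hl'.1 hl'.2) (bdList_mem_on l)

/-- The prism between two maps of vertices. -/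
noncomputable def prismList (R : Type*) [CommRing R] (f g : α → β) : List α → ListChain R β
  | [] => 0
  | a :: l => Finsupp.single (f a :: g a :: l.map g) 1 - cone (f a) (prismList R f g l)

/-- The prism operator, a chain homotopy between the maps induced by `f` and `g`. -/
noncomputable def prism (f g : α → β) : ListChain R α →ₗ[R] ListChain R β :=
  Finsupp.linearCombination R (prismList R f g)

lemma prism_single_one (f g : α → β) (l : List α) :
    prism f g (Finsupp.single l (1 : R)) = prismList R f g l := by
  simp [prism]

lemma prism_cone (f g : α → β) (a : α) (c : ListChain R α) :
    prism f g (cone a c) = cone (f a) (cone (g a) (map g c)) - cone (f a) (prism f g c) := by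
  suffices (prism f g ∘ₗ cone a : ListChain R α →ₗ[R] _) =
      cone (f a) ∘ₗ cone (g a) ∘ₗ map g - cone (f a) ∘ₗ prism f g from LinearMap.congr_fun this c
  refine linearMap_ext fun l => ?_
  simp [prism_single_one, prismList]

lemma bd_prism (f g : α → β) (c : ListChain R α) :
    bd (prism f g c) = map g c - map f c - prism f g (bd c) := by
  suffices (bd ∘ₗ prism f g : ListChain R α →ₗ[R] _) = map g - map f - prism f g ∘ₗ bd from
    LinearMap.congr_fun this c
  refine linearMap_ext fun l => ?_
  simp only [LinearMap.comp_apply, LinearMap.sub_apply, map_single, prism_single_one,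
    bd_single_one]
  induction l with
  | nil => simp [prismList, bdList]
  | cons a l ih =>
    simp only [prismList, map_sub, bd_single_one, bdList, bd_cone, ih, prism_cone,
      cone_single, List.map_cons, prism_single_one]
    rw [← bd_single_one (l.map g), ← map_single, bd_map, bd_single_one]
    abel

lemma prismList_mem_on (f g : α → β) (l : List α) :
    prismList R f g l ∈
      on R {l' | l'.length = l.length + 1 ∧ ∀ y ∈ l', ∃ x ∈ l, y = f x ∨ y = g x} := by
  induction l with
  | nil => simp [prismList]
  | cons a l ih =>
    refine sub_mem (single_mem_on ?_ 1) (cone_mem_on ?_ ih)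
    · simp only [Set.mem_ofPred_eq, List.length_cons, List.length_map, true_and]
      intro y hy
      simp only [List.mem_cons, List.mem_map] at hy ⊢
      grind
    · rintro l' ⟨h, h'⟩
      refine ⟨by simp [h], fun y hy => ?_⟩
      simp only [List.mem_cons] at hy ⊢
      grind

/-- Generalised barycentric subdivision: simplices of length `k` are subdivided using `b` as a
choice of barycentre. -/
noncomputable def sd (b : List α → β) : ℕ → (ListChain R α →ₗ[R] ListChain R β)
  | 0 => Finsupp.linearCombination R fun _ => Finsupp.single [] 1
  | k + 1 => Finsupp.linearCombination R fun l => cone (b l) (sd b k (bdList R l))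

lemma sd_zero_single (b : List α → β) (l : List α) :
    sd b 0 (Finsupp.single l (1 : R)) = Finsupp.single [] 1 := by
  simp [sd]

lemma sd_succ_single (b : List α → β) (k : ℕ) (l : List α) :
    sd b (k + 1) (Finsupp.single l (1 : R)) = cone (b l) (sd b k (bdList R l)) := by
  simp [sd]

lemma bd_mem_on_length {k : ℕ} {c : ListChain R α} (hc : c ∈ on R {l | l.length = k + 1}) :
    bd c ∈ on R {l | l.length = k} :=
  bd_mem_on (fun l hl l' _ h => by simp at hl ⊢; omega) hc

lemma bd_sd (b : List α → β) (k : ℕ) {c : ListChain R α}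
    (hc : c ∈ on R {l | l.length = k + 1}) : bd (sd b (k + 1) c) = sd b k (bd c) := by
  induction k generalizing c with
  | zero =>
    refine sub_eq_zero.1 ((Submodule.mem_bot R).1 (apply_mem_of_forall
      (bd ∘ₗ sd b 1 - sd b 0 ∘ₗ bd) (p := ⊥) (fun l hl => ?_) hc))
    obtain ⟨a, rfl⟩ := List.length_eq_one_iff.1 hl
    simp [sd_succ_single, bdList, sd_zero_single, bd_single_one]
  | succ k ih =>
    refine sub_eq_zero.1 ((Submodule.mem_bot R).1 (apply_mem_of_forall
      (bd ∘ₗ sd b (k + 1 + 1) - sd b (k + 1) ∘ₗ bd) (p := ⊥) (fun l hl => ?_) hc))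
    have hl' : bdList R l ∈ on R {l : List α | l.length = k + 1} := by
      rw [← bd_single_one]
      exact bd_mem_on_length (single_mem_on hl 1)
    have : bd (bdList R l) = 0 := by rw [← bd_single_one, bd_bd]
    simp only [LinearMap.sub_apply, LinearMap.comp_apply, sd_succ_single, bd_cone, ih hl',
      bd_single_one, this, map_zero, sub_zero, sub_self, Submodule.mem_bot]

lemma sd_map {α' β' : Type*} (b : List α → β) (b' : List α' → β') (f : α → α') (h : β → β')
    (hb : ∀ l, l ≠ [] → b' (l.map f) = h (b l)) (k : ℕ) {c : ListChain R α}
    (hc : c ∈ on R {l | l.length = k}) : sd b' k (map f c) = map h (sd b k c) := by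
  induction k generalizing c with
  | zero =>
    refine sub_eq_zero.1 ((Submodule.mem_bot R).1 (apply_mem_of_forall
      (sd b' 0 ∘ₗ map f - map h ∘ₗ sd b 0) (p := ⊥) (fun l hl => ?_) hc))
    simp [sd_zero_single]
  | succ k ih =>
    refine sub_eq_zero.1 ((Submodule.mem_bot R).1 (apply_mem_of_forall
      (sd b' (k + 1) ∘ₗ map f - map h ∘ₗ sd b (k + 1)) (p := ⊥) (fun l hl => ?_) hc))
    have hl' : bdList R l ∈ on R {l : List α | l.length = k} := by
      rw [← bd_single_one]
      exact bd_mem_on_length (single_mem_on hl 1)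
    have hne : l ≠ [] := by rintro rfl; simp at hl
    have h1 : bdList R (l.map f) = map f (bdList R l) := by
      rw [← bd_single_one, ← bd_single_one, ← bd_map, map_single]
    simp only [LinearMap.sub_apply, LinearMap.comp_apply, map_single, sd_succ_single, map_cone,
      hb l hne, h1, ih hl', sub_self, Submodule.mem_bot]

end Basic

end ListChain

namespace ListChain

section Cyclic

variable {R α β G : Type*} [CommRing R] [Group G] [MulAction G α] [MulAction G β]

/-- The difference operator `g - 1`. -/
noncomputable def diffOp (g : G) : ListChain R α →ₗ[R] ListChain R α :=
  map (g • ·) - LinearMap.id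

/-- The norm operator `1 + g + ⋯ + g ^ (m - 1)`, with `m` the order of `g`. -/
noncomputable def normOp (g : G) : ListChain R α →ₗ[R] ListChain R α :=
  ∑ j ∈ Finset.range (orderOf g), map (g ^ j • ·)

/-- The operators of the minimal periodic resolution of a cyclic group. -/
noncomputable def cycOp (g : G) (r : ℕ) : ListChain R α →ₗ[R] ListChain R α :=
  if Odd r then diffOp g else normOp g

lemma map_smul_map_smul (g h : G) (c : ListChain R α) :
    map (g • ·) (map (h • ·) c) = map ((g * h) • ·) c := by
  rw [map_map]
  congr 2
  funext x
  simp [mul_smul]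

lemma cycOp_comm {g : G} {r : ℕ} (F : ListChain R α →ₗ[R] ListChain R β) (c : ListChain R α)
    (h : ∀ k : G, F (map (k • ·) c) = map (k • ·) (F c)) :
    F (cycOp g r c) = cycOp g r (F c) := by
  unfold cycOp
  split_ifs
  · simp [diffOp, h]
  · simp [normOp, h]

lemma bd_cycOp (g : G) (r : ℕ) (c : ListChain R α) : bd (cycOp g r c) = cycOp g r (bd c) :=
  cycOp_comm _ _ fun _ => bd_map _ _

lemma diffOp_normOp (g : G) (c : ListChain R α) : diffOp g (normOp g c) = 0 := by
  have h : ∀ j : ℕ, map (g • ·) (map (g ^ j • ·) c) = map (g ^ (j + 1) • ·) c := fun j => by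
    rw [map_smul_map_smul, pow_succ']
  simp only [normOp, diffOp, LinearMap.sub_apply, LinearMap.id_apply, LinearMap.sum_apply,
    map_sum, h]
  rw [Finset.sum_range_sub (fun j => map (g ^ j • ·) c)]
  simp [pow_orderOf_eq_one]

lemma normOp_diffOp (g : G) (c : ListChain R α) : normOp g (diffOp g c) = 0 := by
  have h : ∀ j : ℕ, map (g ^ j • ·) (map (g • ·) c) = map (g ^ (j + 1) • ·) c := fun j => by
    rw [map_smul_map_smul, pow_succ]
  simp only [normOp, diffOp, LinearMap.sub_apply, LinearMap.id_apply, LinearMap.sum_apply,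
    map_sub, h, ← Finset.sum_sub_distrib]
  rw [Finset.sum_range_sub (fun j => map (g ^ j • ·) c)]
  simp [pow_orderOf_eq_one]

lemma cycOp_succ_cycOp (g : G) (r : ℕ) (c : ListChain R α) :
    cycOp g (r + 1) (cycOp g r c) = 0 := by
  by_cases h : Odd r
  · simp [cycOp, h, Nat.odd_add_one, normOp_diffOp]
  · simp [cycOp, h, Nat.odd_add_one, diffOp_normOp]

lemma cycOp_mem_on {s : Set (List α)} {g : G} (hs : ∀ k : G, ∀ l ∈ s, l.map (k • ·) ∈ s) (r : ℕ)
    {c : ListChain R α} (hc : c ∈ on R s) : cycOp g r c ∈ on R s := by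
  unfold cycOp
  split_ifs
  · exact sub_mem (map_mem_on (hs _) hc) hc
  · rw [normOp, LinearMap.sum_apply]
    exact sum_mem fun j _ => map_mem_on (hs _) hc

end Cyclic

/-- The lists with two equal adjacent entries. -/
def degenerate (α : Type*) : Set (List α) := {l | ¬ l.IsChain (· ≠ ·)}

lemma map_smul_mem_degenerate {α G : Type*} [Group G] [MulAction G α] (k : G) (l : List α)
    (hl : l ∈ degenerate α) : l.map (k • ·) ∈ degenerate α := by
  simpa [degenerate, List.isChain_map] using hl

lemma bdList_mem_degenerate {R α : Type*} [CommRing R] (l : List α) (hl : l ∈ degenerate α) :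
    bdList R l ∈ on R (degenerate α) := by
  have hcons : ∀ (a : α), ∀ l ∈ degenerate α, a :: l ∈ degenerate α := fun a l hl h =>
    hl h.of_cons
  induction l with
  | nil => simp [degenerate] at hl
  | cons a l ih =>
    by_cases h : l ∈ degenerate α
    · exact sub_mem (single_mem_on h 1) (cone_mem_on (hcons a) (ih h))
    · cases l with
      | nil => simp [degenerate] at hl
      | cons b l =>
        have hab : a = b := by
          simp only [degenerate, Set.mem_ofPred_eq, List.isChain_cons_cons, not_and, not_not] at hl h
          by_contra hne
          exact hl hne h
        subst hab
        have : bdList R (a :: a :: l) = cone a (cone a (bdList R l)) := by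
          simp [bdList]
        rw [this]
        have h2 : bdList R l ∈ on R Set.univ := by simp
        have h3 : cone a (bdList R l) ∈ on R {l | ∃ l', l = a :: l'} :=
          cone_mem_on (by simp) h2
        refine cone_mem_on ?_ h3
        rintro _ ⟨l', rfl⟩
        simp [degenerate]

section Transgression

variable {R G : Type*} [CommRing R] [Group G]

lemma exists_comp_normOp_eq [Finite G] {g : G} (gen : ∀ x, x ∈ Subgroup.zpowers g)
    (b : ListChain R G →ₗ[R] R) (hnil : b (Finsupp.single [] 1) = 0)
    (hb : ∀ c, b (diffOp g c) = 0)
    (hdeg : ∀ l ∈ degenerate G, b (Finsupp.single l 1) = 0) :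
    ∃ θ : ListChain R G →ₗ[R] R, (∀ c, θ (normOp g c) = b c) ∧
      ∀ l ∈ degenerate G, θ (Finsupp.single l 1) = 0 := by
  classical
  have hg : ∀ c, b (map (g • ·) c) = b c := fun c => by
    simpa [diffOp, sub_eq_zero] using hb c
  have hgj : ∀ (j : ℕ) c, b (map (g ^ j • ·) c) = b c := by
    intro j
    induction j with
    | zero => intro c; simpa using! congrArg b (map_id c)
    | succ j ih => intro c; rw [pow_succ', ← map_smul_map_smul, hg, ih]
  refine ⟨Finsupp.linearCombination R fun l =>
    if l.head? = some 1 then b (Finsupp.single l 1) else 0, fun c => ?_, fun l hl => ?_⟩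
  · suffices (Finsupp.linearCombination R fun l =>
        if l.head? = some 1 then b (Finsupp.single l 1) else 0) ∘ₗ normOp g = b from LinearMap.congr_fun this c
    refine linearMap_ext fun l => ?_
    cases l with
    | nil => simp [normOp, hnil]
    | cons a l =>
      obtain ⟨k, hk, hka⟩ : ∃ k ∈ Finset.range (orderOf g), g ^ k = a⁻¹ := by
        have := gen a⁻¹
        rw [← mem_powers_iff_mem_zpowers, mem_powers_iff_mem_range_orderOf] at this
        simpa using this
      have hmap : ∀ j : ℕ, Finsupp.single ((g ^ j * a) :: l.map (g ^ j * ·)) (1 : R) =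
        map (g ^ j • ·) (Finsupp.single (a :: l) 1) := fun j => by simp
      simp only [normOp, LinearMap.comp_apply, LinearMap.sum_apply, map_sum, map_single,
        Finsupp.linearCombination_single, List.map_cons, List.head?_cons, smul_eq_mul,
        Option.some.injEq]
      simp only [hmap, hgj]
      rw [Finset.sum_eq_single k]
      · simp [hka]
      · intro j hj hjk
        rw [if_neg, mul_zero]
        intro h
        apply hjk
        rw [mul_eq_one_iff_eq_inv, ← hka] at h
        exact pow_injOn_Iio_orderOf (by simpa using hj) (by simpa using hk) h
      · exact fun h => absurd hk h
  · simp [hdeg l hl]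

lemma exists_comp_diffOp_eq [Finite G] {g : G} (gen : ∀ x, x ∈ Subgroup.zpowers g)
    (b : ListChain R G →ₗ[R] R) (hnil : b (Finsupp.single [] 1) = 0)
    (hb : ∀ c, b (normOp g c) = 0)
    (hdeg : ∀ l ∈ degenerate G, b (Finsupp.single l 1) = 0) :
    ∃ θ : ListChain R G →ₗ[R] R, (∀ c, θ (diffOp g c) = b c) ∧
      ∀ l ∈ degenerate G, θ (Finsupp.single l 1) = 0 := by
  classical
  have hk : ∀ a : G, ∃ k ∈ Finset.range (orderOf g), g ^ k = a := fun a => by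
    have := gen a
    rw [← mem_powers_iff_mem_zpowers, mem_powers_iff_mem_range_orderOf] at this
    simpa using this
  choose e he hge using hk
  have hpos : 0 < orderOf g := orderOf_pos g
  let w : List G → R := fun l => match l with
    | [] => 0
    | a :: l => ∑ j ∈ Finset.range (e a), b (map (g ^ j • ·) (map (a⁻¹ • ·)
        (Finsupp.single (a :: l) 1)))
  refine ⟨Finsupp.linearCombination R w, fun c => ?_, fun l hl => ?_⟩
  · suffices Finsupp.linearCombination R w ∘ₗ diffOp g = b from LinearMap.congr_fun this c
    refine linearMap_ext fun l => ?_
    cases l with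
    | nil => simp [diffOp, hnil]
    | cons a l =>
      set s : ListChain R G := map (a⁻¹ • ·) (Finsupp.single (a :: l) 1) with hs
      have h1 : w (g • a :: l.map (g • ·)) =
          ∑ j ∈ Finset.range (e (g • a)), b (map (g ^ j • ·) s) := by
        have : map ((g • a)⁻¹ • ·) (Finsupp.single (g • a :: l.map (g • ·)) (1 : R)) = s := by
          rw [hs, map_single, map_single]
          simp [Function.comp_def, mul_assoc]
        simp only [w, this]
      have h2 : w (a :: l) = ∑ j ∈ Finset.range (e a), b (map (g ^ j • ·) s) := rfl
      have h3 : b (map (g ^ e a • ·) s) = b (Finsupp.single (a :: l) 1) := by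
        rw [hs, map_smul_map_smul, hge]
        simp
      have h4 : ∑ j ∈ Finset.range (orderOf g), b (map (g ^ j • ·) s) = 0 := by
        have := hb s
        simpa [normOp] using this
      have h5 : (Finsupp.linearCombination R w ∘ₗ diffOp g) (Finsupp.single (a :: l) 1) =
          w (g • a :: l.map (g • ·)) - w (a :: l) := by
        simp [diffOp]
      rw [h5, h1, h2, ← h3]
      have hlt := Finset.mem_range.1 (he a)
      have hlt' := Finset.mem_range.1 (he (g • a))
      have hpow : g ^ e (g • a) = g ^ (e a + 1) := by rw [hge, pow_succ', hge, smul_eq_mul]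
      rcases Nat.lt_or_ge (e a + 1) (orderOf g) with h | h
      · rw [pow_injOn_Iio_orderOf hlt' h hpow, Finset.sum_range_succ]
        ring
      · have hm : e a + 1 = orderOf g := by omega
        have : e (g • a) = 0 := by
          refine pow_injOn_Iio_orderOf hlt' hpos ?_
          change g ^ e (g • a) = g ^ 0
          rw [hpow, hm, pow_orderOf_eq_one, pow_zero]
        rw [← hm, Finset.sum_range_succ] at h4
        rw [this, Finset.sum_range_zero, zero_sub, eq_comm, eq_neg_iff_add_eq_zero, add_comm]
        exact h4
  · cases l with
    | nil => simp [degenerate] at hl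
    | cons a l =>
      simp only [Finsupp.linearCombination_single, one_smul, w]
      refine Finset.sum_eq_zero fun j _ => ?_
      rw [map_smul_map_smul, map_single]
      exact hdeg _ (map_smul_mem_degenerate _ _ hl)

/-- A cochain whose coboundary can be transgressed one degree further. -/
structure Transgressive (g : G) (r : ℕ) (θ : ListChain R G →ₗ[R] R) : Prop where
  bd_cycOp : ∀ c, θ (bd (cycOp g r c)) = 0
  degenerate : ∀ l ∈ degenerate G, θ (Finsupp.single l 1) = 0

lemma Transgressive.exists_succ [Finite G] {g : G} (gen : ∀ x, x ∈ Subgroup.zpowers g) {r : ℕ}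
    {θ : ListChain R G →ₗ[R] R} (h : Transgressive g r θ) :
    ∃ θ' : ListChain R G →ₗ[R] R, Transgressive g (r + 1) θ' ∧
      ∀ c, θ' (cycOp g (r + 1) c) = θ (bd c) := by
  have hdeg : ∀ l ∈ ListChain.degenerate G, (θ ∘ₗ bd) (Finsupp.single l 1) = 0 := fun l hl => by
    rw [← Submodule.mem_bot R, LinearMap.comp_apply, bd_single_one]
    exact apply_mem_of_forall _ (fun l hl => (Submodule.mem_bot R).2 (h.degenerate l hl))
      (bdList_mem_degenerate l hl)
  obtain ⟨θ', h1, h2⟩ : ∃ θ' : ListChain R G →ₗ[R] R, (∀ c, θ' (cycOp g (r + 1) c) = θ (bd c)) ∧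
      ∀ l ∈ ListChain.degenerate G, θ' (Finsupp.single l 1) = 0 := by
    have hr := h.bd_cycOp
    by_cases ho : Odd r
    · simp only [cycOp, ho, Nat.odd_add_one, if_true, not_true_eq_false, if_false] at hr ⊢
      exact exists_comp_normOp_eq gen (θ ∘ₗ bd) (by simp) hr hdeg
    · simp only [cycOp, ho, Nat.odd_add_one, if_true, not_false_eq_true, if_false] at hr ⊢
      exact exists_comp_diffOp_eq gen (θ ∘ₗ bd) (by simp) hr hdeg
  exact ⟨θ', ⟨fun c => by rw [ListChain.bd_cycOp, h1, bd_bd, map_zero], h2⟩, h1⟩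

lemma exists_transgressive_zero (g : G) (hR : (orderOf g : R) = 0) :
    ∃ θ : ListChain R G →ₗ[R] R, Transgressive g 0 θ ∧ θ (Finsupp.single [] 1) = 1 := by
  classical
  refine ⟨Finsupp.linearCombination R fun l => if l = [] then 1 else 0, ⟨fun c => ?_, ?_⟩, by simp⟩
  · set θ : ListChain R G →ₗ[R] R := Finsupp.linearCombination R fun l => if l = [] then 1 else 0
    have key : ∀ (k : G) c, θ (map (k • ·) c) = θ c := fun k c => by
      suffices θ ∘ₗ map (k • ·) = θ from LinearMap.congr_fun this c
      refine linearMap_ext fun l => ?_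
      simp [θ]
    rw [ListChain.bd_cycOp]
    simp only [cycOp, normOp, Nat.not_odd_zero, if_false, LinearMap.sum_apply, map_sum, key]
    simp [hR]
  · rintro l hl
    have : l ≠ [] := by rintro rfl; simp [ListChain.degenerate] at hl
    simp [this]

end Transgression
end ListChain

section JoinSpace

variable {ι G : Type*} [Group G]

/-- The left regular action on real functions on a group. -/
@[reducible] def regularMulAction : MulAction G (G → ℝ) where
  smul g u a := u (g⁻¹ * a)
  one_smul u := by funext a; change u (1⁻¹ * a) = u a; simp
  mul_smul g h u := by
    funext a
    change u ((g * h)⁻¹ * a) = u (h⁻¹ * (g⁻¹ * a))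
    rw [mul_inv_rev, mul_assoc]

attribute [local instance] regularMulAction

lemma regular_smul_apply (g : G) (u : G → ℝ) (a : G) : (g • u) a = u (g⁻¹ * a) := rfl

lemma regular_pi_smul_apply (g : G) (w : ι → G → ℝ) (i : ι) (a : G) :
    (g • w) i a = w i (g⁻¹ * a) := rfl

instance [Fintype G] : IsIsometricSMul G (G → ℝ) where
  isometry_smul g := Isometry.of_dist_eq fun u v => by
    refine le_antisymm ?_ ?_
    · exact (dist_pi_le_iff dist_nonneg).2 fun a => dist_le_pi_dist u v (g⁻¹ * a)
    · refine (dist_pi_le_iff dist_nonneg).2 fun a => ?_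
      simpa [regular_smul_apply] using dist_le_pi_dist (g • u) (g • v) (g * a)

variable (G) in
/-- The `r`-fold join of the discrete space `G` with itself, in barycentric coordinates: the
coordinates `w i a` are nonnegative with sum `1`, for each `i` at most one of them is nonzero,
and they vanish for `r ≤ i`. -/
def joinSpace [Fintype G] (N r : ℕ) : Set (Fin N → G → ℝ) :=
  {w | (∀ i a, 0 ≤ w i a) ∧ (∀ i a b, a ≠ b → w i a * w i b = 0) ∧
    (∀ i : Fin N, r ≤ (i : ℕ) → w i = 0) ∧ ∑ i, ∑ a, w i a = 1}

/-- The vertex of the join with coordinates `i`, `a`. -/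
noncomputable def joinVertex {N : ℕ} (i : Fin N) (a : G) : Fin N → G → ℝ :=
  open Classical in Pi.single i (Pi.single a 1)

namespace joinSpace

variable [Fintype G] {N r : ℕ}

lemma smul_mem (g : G) {w : Fin N → G → ℝ} (hw : w ∈ joinSpace G N r) :
    g • w ∈ joinSpace G N r := by
  obtain ⟨h0, h1, h2, h3⟩ := hw
  refine ⟨fun i a => h0 i _, fun i a b hab => h1 i _ _ (by simpa using hab), fun i hi => ?_, ?_⟩
  · funext a
    simp [regular_pi_smul_apply, h2 i hi]
  · rw [← h3]
    refine Finset.sum_congr rfl fun i _ => ?_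
    exact Fintype.sum_equiv (Equiv.mulLeft g⁻¹) _ _ fun a => rfl

lemma mono {r s : ℕ} (h : r ≤ s) : joinSpace G N r ⊆ joinSpace G N s :=
  fun _ hw => ⟨hw.1, hw.2.1, fun i hi => hw.2.2.1 i (h.trans hi), hw.2.2.2⟩

lemma zero_eq_empty : joinSpace G N 0 = ∅ := by
  refine Set.eq_empty_of_forall_notMem fun w hw => ?_
  have := hw.2.2.2
  simp [hw.2.2.1] at this

lemma le_one {w : Fin N → G → ℝ} (hw : w ∈ joinSpace G N r) (i : Fin N) (a : G) : w i a ≤ 1 := by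
  rw [← hw.2.2.2]
  calc w i a ≤ ∑ a, w i a := Finset.single_le_sum (fun a _ => hw.1 i a) (Finset.mem_univ a)
    _ ≤ _ := Finset.single_le_sum (f := fun i => ∑ a, w i a)
      (fun i _ => Finset.sum_nonneg fun a _ => hw.1 i a) (Finset.mem_univ i)

lemma norm_le_one {w : Fin N → G → ℝ} (hw : w ∈ joinSpace G N r) : ‖w‖ ≤ 1 := by
  refine (pi_norm_le_iff_of_nonneg zero_le_one).2 fun i =>
    (pi_norm_le_iff_of_nonneg zero_le_one).2 fun a => ?_
  rw [Real.norm_eq_abs, abs_of_nonneg (hw.1 i a)]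
  exact le_one hw i a

lemma isClosed : IsClosed (joinSpace G N r) := by
  simp only [joinSpace, Set.ofPred_and, Set.ofPred_forall]
  refine IsClosed.inter ?_ (IsClosed.inter ?_ (IsClosed.inter ?_ ?_))
  · exact isClosed_iInter fun i => isClosed_iInter fun a =>
      isClosed_le continuous_const (by fun_prop)
  · exact isClosed_iInter fun i => isClosed_iInter fun a => isClosed_iInter fun b =>
      isClosed_iInter fun _ => isClosed_eq (by fun_prop) continuous_const
  · exact isClosed_iInter fun i => isClosed_iInter fun _ =>
      isClosed_eq (by fun_prop) continuous_const
  · exact isClosed_eq (by fun_prop) continuous_const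

lemma isCompact : IsCompact (joinSpace G N r) :=
  Metric.isCompact_of_isClosed_isBounded isClosed
    ((Metric.isBounded_closedBall (x := 0) (r := 1)).subset fun w hw => by
      simpa using norm_le_one hw)

lemma joinVertex_mem {i : Fin N} (hi : (i : ℕ) < r) (a : G) : joinVertex i a ∈ joinSpace G N r := by
  classical
  refine ⟨fun j b => ?_, fun j b c hbc => ?_, fun j hj => ?_, ?_⟩
  · by_cases hj : j = i
    · subst hj
      simp only [joinVertex, Pi.single_eq_same, Pi.single_apply]
      split_ifs <;> simp
    · simp [joinVertex, hj]
  · by_cases hj : j = i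
    · subst hj
      simp only [joinVertex, Pi.single_eq_same, Pi.single_apply]
      grind
    · simp [joinVertex, hj]
  · have : j ≠ i := by rintro rfl; omega
    simp [joinVertex, this]
  · rw [Finset.sum_eq_single i]
    · simp [joinVertex]
    · intro j _ hj
      simp [joinVertex, hj]
    · simp

/-- The straight line from `w` to the vertex with coordinates `i`, `1`. -/
noncomputable def contract (i : Fin N) (t : ℝ) (w : Fin N → G → ℝ) : Fin N → G → ℝ :=
  (1 - t) • w + t • joinVertex i 1

lemma contract_zero (i : Fin N) (w : Fin N → G → ℝ) : contract i 0 w = w := by simp [contract]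

lemma contract_mem {i : Fin N} {t : ℝ} (ht : t ∈ Set.Icc (0 : ℝ) 1) {w : Fin N → G → ℝ}
    (hw : w ∈ joinSpace G N i) : contract i t w ∈ joinSpace G N (i + 1) := by
  have he : joinVertex i (1 : G) ∈ joinSpace G N (i + 1) := joinVertex_mem (Nat.lt_succ_self _) 1
  obtain ⟨h0, h1, h2, h3⟩ := hw
  obtain ⟨e0, e1, e2, e3⟩ := he
  have ht' : 0 ≤ 1 - t := by linarith [ht.2]
  refine ⟨fun j a => ?_, fun j a b hab => ?_, fun j hj => ?_, ?_⟩
  · exact add_nonneg (mul_nonneg ht' (h0 j a)) (mul_nonneg ht.1 (e0 j a))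
  · change ((1 - t) * w j a + t * joinVertex i 1 j a) *
      ((1 - t) * w j b + t * joinVertex i 1 j b) = 0
    by_cases hj : j = i
    · have := e1 j a b hab
      rw [h2 j (by rw [hj])]
      simp only [Pi.zero_apply, mul_zero, zero_add]
      linear_combination t ^ 2 * this
    · have := h1 j a b hab
      have hz : joinVertex i (1 : G) j = 0 := by simp [joinVertex, hj]
      rw [hz]
      simp only [Pi.zero_apply, mul_zero, add_zero]
      linear_combination (1 - t) ^ 2 * this
  · simp [contract, h2 j (by omega), e2 j hj]
  · simp only [contract, Pi.add_apply, Pi.smul_apply, smul_eq_mul, Finset.sum_add_distrib,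
      ← Finset.mul_sum, h3, e3]
    ring

lemma dist_contract_le {i : Fin N} {s t : ℝ} (ht : t ∈ Set.Icc (0 : ℝ) 1) {v w : Fin N → G → ℝ}
    (hv : v ∈ joinSpace G N i) :
    dist (contract i s v) (contract i t w) ≤ dist v w + 2 * |s - t| := by
  have he : ‖joinVertex i (1 : G)‖ ≤ 1 := norm_le_one (joinVertex_mem (Nat.lt_succ_self (i : ℕ)) 1)
  have hv := norm_le_one hv
  have : contract i s v - contract i t w = (1 - t) • (v - w) + (s - t) • (joinVertex i 1 - v) := by
    simp only [contract]
    module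
  rw [dist_eq_norm, this, dist_eq_norm]
  refine (norm_add_le _ _).trans (add_le_add ?_ ?_)
  · rw [norm_smul, Real.norm_eq_abs, abs_of_nonneg (by linarith [ht.2])]
    exact mul_le_of_le_one_left (norm_nonneg _) (by linarith [ht.1])
  · rw [norm_smul, Real.norm_eq_abs, mul_comm]
    exact mul_le_mul_of_nonneg_right ((norm_sub_le _ _).trans (by linarith)) (abs_nonneg _)

end joinSpace

end JoinSpace

section FineChain
open ListChain
variable {G : Type*} [Group G] [Fintype G]
attribute [local instance] regularMulAction

variable (G) in
/-- The lists of length `k` of points of the `r`-fold join with mutual distances below `ε`. -/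
def fineLists (N r k : ℕ) (ε : ℝ) : Set (List (Fin N → G → ℝ)) :=
  {l | l.length = k ∧ (∀ x ∈ l, x ∈ joinSpace G N r) ∧ ∀ x ∈ l, ∀ y ∈ l, dist x y < ε}

variable {R : Type*} [CommRing R] {N : ℕ}

lemma map_smul_mem_fineLists {r k : ℕ} {ε : ℝ} (g : G) (l : List (Fin N → G → ℝ))
    (hl : l ∈ fineLists G N r k ε) : l.map (g • ·) ∈ fineLists G N r k ε := by
  obtain ⟨h1, h2, h3⟩ := hl
  refine ⟨by simpa using h1, fun x hx => ?_, fun x hx y hy => ?_⟩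
  · obtain ⟨x, hxl, rfl⟩ := List.mem_map.1 hx
    exact joinSpace.smul_mem g (h2 x hxl)
  · obtain ⟨x, hxl, rfl⟩ := List.mem_map.1 hx
    obtain ⟨y, hyl, rfl⟩ := List.mem_map.1 hy
    simpa using h3 x hxl y hyl

open joinSpace in
lemma exists_bd_eq_of_mem_fineLists (i : Fin N) (k : ℕ) {ε : ℝ} (hε : 0 < ε)
    {z : ListChain R (Fin N → G → ℝ)} (hz : z ∈ on R (fineLists G N i k (ε / 2)))
    (hbd : bd z = 0) :
    ∃ c ∈ on R (fineLists G N (i + 1) (k + 1) ε), bd c = z := by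
  obtain ⟨M, hM⟩ := exists_nat_one_div_lt (show 0 < ε / 4 by positivity)
  have hM0 : (0 : ℝ) < M + 1 := by positivity
  let t : ℕ → ℝ := fun j => j / (M + 1)
  have ht : ∀ j ≤ M + 1, t j ∈ Set.Icc (0 : ℝ) 1 := fun j hj => by
    refine ⟨by positivity, (div_le_one hM0).2 (by exact_mod_cast hj)⟩
  have hdist : ∀ {l}, l ∈ fineLists G N i k (ε / 2) → ∀ x ∈ l, ∀ y ∈ l, ∀ a b, b ≤ M + 1 →
      |t a - t b| ≤ 1 / (M + 1) → dist (contract i (t a) x) (contract i (t b) y) < ε := by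
    intro l hl x hx y hy a b hb hab
    have h1 := dist_contract_le (w := y) (s := t a) (ht b hb) (hl.2.1 x hx)
    have h2 := hl.2.2 x hx y hy
    linarith
  have hstep : ∀ j, |t j - t (j + 1)| = 1 / (M + 1) := fun j => by
    have : t j - t (j + 1) = - (1 / (M + 1)) := by
      simp only [t]; push_cast; ring
    rw [this, abs_neg, abs_of_pos (by positivity)]
  let P : ListChain R (Fin N → G → ℝ) :=
    ∑ j ∈ Finset.range M, prism (contract i (t j)) (contract i (t (j + 1))) z
  refine ⟨cone (joinVertex i 1) (map (contract i (t M)) z) - P, sub_mem ?_ ?_, ?_⟩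
  · refine cone_mem_on (s := List.map (contract i (t M)) '' fineLists G N i k (ε / 2)) ?_
      (map_mem_on (fun l hl => Set.mem_image_of_mem _ hl) hz)
    rintro _ ⟨l, hl, rfl⟩
    have he : ∀ w : Fin N → G → ℝ, joinVertex i 1 = contract i (t (M + 1)) w := fun w => by
      have : t (M + 1) = 1 := by simp only [t]; push_cast; exact div_self hM0.ne'
      simp [contract, this]
    have hMM : |t M - t M| ≤ 1 / (M + 1) := by simpa using hM0.le
    refine ⟨by simp [hl.1], fun x hx => ?_, fun x hx y hy => ?_⟩
    · rcases List.mem_cons.1 hx with rfl | hx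
      · exact joinVertex_mem (Nat.lt_succ_self _) 1
      · obtain ⟨x, hxl, rfl⟩ := List.mem_map.1 hx
        exact contract_mem (ht M (Nat.le_succ M)) (hl.2.1 x hxl)
    · rcases List.mem_cons.1 hx with rfl | hx <;> rcases List.mem_cons.1 hy with rfl | hy
      · simpa using hε
      · obtain ⟨y, hyl, rfl⟩ := List.mem_map.1 hy
        rw [he y, dist_comm]
        exact hdist hl y hyl y hyl M (M + 1) le_rfl (hstep M).le
      · obtain ⟨x, hxl, rfl⟩ := List.mem_map.1 hx
        rw [he x]
        exact hdist hl x hxl x hxl M (M + 1) le_rfl (hstep M).le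
      · obtain ⟨x, hxl, rfl⟩ := List.mem_map.1 hx
        obtain ⟨y, hyl, rfl⟩ := List.mem_map.1 hy
        exact hdist hl x hxl y hyl M M (Nat.le_succ M) hMM
  · refine sum_mem fun j hj => apply_mem_of_forall _ (fun l hl => ?_) hz
    rw [Finset.mem_range] at hj
    rw [prism_single_one]
    refine Finsupp.supported_mono ?_ (prismList_mem_on _ _ l)
    rintro l' ⟨h1, h2⟩
    have h2' : ∀ y ∈ l', ∃ x ∈ l, ∃ a, (a = j ∨ a = j + 1) ∧ y = contract i (t a) x := by
      intro y hy
      obtain ⟨x, hx, h | h⟩ := h2 y hy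
      exacts [⟨x, hx, j, Or.inl rfl, h⟩, ⟨x, hx, j + 1, Or.inr rfl, h⟩]
    refine ⟨by rw [h1, hl.1], fun y hy => ?_, fun y hy y' hy' => ?_⟩
    · obtain ⟨x, hx, a, ha, rfl⟩ := h2' y hy
      exact contract_mem (ht a (by omega)) (hl.2.1 x hx)
    · obtain ⟨x, hx, a, ha, rfl⟩ := h2' y hy
      obtain ⟨x', hx', b, hb, rfl⟩ := h2' y' hy'
      refine hdist hl x hx x' hx' a b (by omega) ?_
      rcases ha with rfl | rfl <;> rcases hb with rfl | rfl
      · simpa using hM0.le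
      · exact (hstep _).le
      · rw [abs_sub_comm]; exact (hstep _).le
      · simpa using hM0.le
  · have h0 : map (contract i (t 0)) z = z := by
      have : contract (G := G) i (t 0) = id := funext fun w => by
        simpa [t] using contract_zero i w
      rw [this, map_id]
    simp only [P, map_sub, bd_cone, bd_map, hbd, map_zero, sub_zero, map_sum, bd_prism]
    rw [Finset.sum_range_sub (fun j => map (contract i (t j)) z), h0]
    abel

/-- Fine invariant cycles in the joins on which the successive transgressions of the
augmentation do not vanish, after applying a chain map `μ`. -/
lemma exists_transgressive_fine {g : G} (gen : ∀ x, x ∈ Subgroup.zpowers g)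
    (hR : (orderOf g : R) = 0)
    (μ : ℕ → (ListChain R (Fin N → G → ℝ) →ₗ[R] ListChain R G))
    (hμ0 : μ 0 (Finsupp.single [] 1) = Finsupp.single [] 1) {δ : ℝ}
    (hμbd : ∀ k, ∀ c ∈ on R (fineLists G N N (k + 1) δ), bd (μ (k + 1) c) = μ k (bd c))
    (hμsmul : ∀ k, ∀ c ∈ on R (fineLists G N N k δ), ∀ h : G,
      μ k (ListChain.map (h • ·) c) = ListChain.map (h • ·) (μ k c))
    (r : ℕ) (hr : r ≤ N) {ε : ℝ} (hε : 0 < ε) (hεδ : ε ≤ δ) :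
    ∃ (θ : ListChain R G →ₗ[R] R) (z : ListChain R (Fin N → G → ℝ)), Transgressive g r θ ∧
      z ∈ on R (fineLists G N r r ε) ∧ bd z = 0 ∧ cycOp g (r + 1) z = 0 ∧ θ (μ r z) = 1 := by
  have hmono : ∀ {r k : ℕ} {ε : ℝ}, r ≤ N → ε ≤ δ →
      on R (fineLists G N r k ε) ≤ on R (fineLists G N N k δ) := fun hr hε =>
    Finsupp.supported_mono fun l hl => ⟨hl.1, fun x hx => joinSpace.mono hr (hl.2.1 x hx),
      fun x hx y hy => (hl.2.2 x hx y hy).trans_le hε⟩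
  induction r generalizing ε with
  | zero =>
    obtain ⟨θ, hθ, h1⟩ := exists_transgressive_zero g hR
    refine ⟨θ, Finsupp.single [] 1, hθ, single_mem_on (by simp [fineLists]) 1, by simp, ?_, ?_⟩
    · simp [cycOp, diffOp]
    · rw [hμ0, h1]
  | succ r ih =>
    obtain ⟨θ, z, hθ, hz, hbd, hcyc, h1⟩ :=
      ih (by omega) (ε := ε / 2) (by positivity) (by linarith)
    obtain ⟨c, hc, hcz⟩ := exists_bd_eq_of_mem_fineLists ⟨r, hr⟩ r hε hz hbd
    obtain ⟨θ', hθ', hθc⟩ := hθ.exists_succ gen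
    have hc' := hmono hr hεδ hc
    refine ⟨θ', cycOp g (r + 1) c, hθ', cycOp_mem_on (fun k => map_smul_mem_fineLists k) _ hc, ?_,
      cycOp_succ_cycOp g _ c, ?_⟩
    · rw [bd_cycOp, hcz, hcyc]
    · rw [cycOp_comm _ _ (hμsmul _ c hc'), hθc, hμbd _ _ hc', hcz, h1]

end FineChain

section Labelling
open ListChain
attribute [local instance] regularMulAction

/-- The entry of least first coordinate in a list, with default value `d`. -/
def leastLabel {α β : Type*} [LinearOrder α] (d : α × β) (l : List (α × β)) : α × β :=
  (l.argmin Prod.fst).getD d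

section leastLabel

variable {α β : Type*} [LinearOrder α] {d : α × β} {l : List (α × β)}

lemma exists_argmin_eq (hl : l ≠ []) : ∃ m, l.argmin Prod.fst = some m :=
  Option.ne_none_iff_exists'.1 (mt (List.argmin_eq_none (f := Prod.fst)).1 hl)

lemma leastLabel_mem (hl : l ≠ []) : leastLabel d l ∈ l := by
  obtain ⟨m, hm⟩ := exists_argmin_eq hl
  rw [leastLabel, hm]
  exact List.argmin_mem hm

lemma leastLabel_le {p : α × β} (hp : p ∈ l) : (leastLabel d l).1 ≤ p.1 := by
  have hl : l ≠ [] := List.ne_nil_of_mem hp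
  obtain ⟨m, hm⟩ := exists_argmin_eq hl
  rw [leastLabel, hm]
  exact List.le_of_mem_argmin hp hm

lemma leastLabel_map {h : α × β → α × β} (hh : ∀ p, (h p).1 = p.1) (hl : l ≠ []) :
    leastLabel d (l.map h) = h (leastLabel d l) := by
  have key : (l.map h).argmin Prod.fst = (l.argmin Prod.fst).map h := by
    clear hl
    induction l with
    | nil => rfl
    | cons a l ih =>
      rw [List.map_cons, List.argmin_cons, List.argmin_cons, ih]
      cases List.argmin Prod.fst l with
      | none => rfl
      | some c =>
        simp only [Option.map_some, hh]
        split_ifs <;> rfl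
  obtain ⟨m, hm⟩ := exists_argmin_eq hl
  rw [leastLabel, leastLabel, key, hm]
  rfl

lemma sd_leastLabel_mem_on {R : Type*} [CommRing R] (k : ℕ) (hl : l.length = k) :
    sd (leastLabel d) k (Finsupp.single l (1 : R)) ∈
      on R {l' | l'.length = k ∧ (∀ p ∈ l', p ∈ l) ∧ l'.Pairwise (·.1 ≤ ·.1)} := by
  induction k generalizing l with
  | zero => rw [sd_zero_single]; exact single_mem_on (by simp) 1
  | succ k ih =>
    rw [sd_succ_single]
    have h : sd (leastLabel d) k (bdList R l) ∈
        on R {l' | l'.length = k ∧ (∀ p ∈ l', p ∈ l) ∧ l'.Pairwise (·.1 ≤ ·.1)} := by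
      refine apply_mem_of_forall _ (fun m hm => ?_) (bdList_mem_on l)
      refine Finsupp.supported_mono ?_ (ih (l := m) (by have := hm.2; omega))
      exact fun l' hl' => ⟨hl'.1, fun p hp => hm.1.subset (hl'.2.1 p hp), hl'.2.2⟩
    refine cone_mem_on ?_ h
    rintro l' ⟨h1, h2, h3⟩
    refine ⟨by simp [h1], fun p hp => ?_, List.pairwise_cons.2 ⟨fun p hp => ?_, h3⟩⟩
    · rcases List.mem_cons.1 hp with rfl | hp
      · exact leastLabel_mem (by rintro rfl; simp at hl)
      · exact h2 p hp
    · exact leastLabel_le (h2 p hp)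

lemma map_snd_sd_leastLabel_mem_degenerate {R β : Type*} [CommRing R] {q : ℕ} {d : Fin q × β}
    {l : List (Fin q × β)} (hl : l.length = q + 1)
    (h : ∀ p ∈ l, ∀ p' ∈ l, p.1 = p'.1 → p.2 = p'.2) :
    map Prod.snd (sd (leastLabel d) (q + 1) (Finsupp.single l (1 : R))) ∈ on R (degenerate β) := by
  refine map_mem_on ?_ (sd_leastLabel_mem_on _ hl)
  rintro l' ⟨h1, h2, h3⟩ hchain
  have hchain' : l'.IsChain (·.1 < ·.1) := by
    rw [List.isChain_map] at hchain
    have h3 := h3.isChain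
    clear h1
    induction l' with
    | nil => simp
    | cons a l' ih =>
      cases l' with
      | nil => simp
      | cons b l' =>
        rw [List.isChain_cons_cons] at hchain h3 ⊢
        refine ⟨lt_of_le_of_ne h3.1 fun hab => hchain.1 ?_, ih (fun p hp => h2 p (by simp [hp]))
          (by have := ‹List.Pairwise _ _›; exact this.of_cons) hchain.2 h3.2⟩
        exact h a (h2 a (by simp)) b (h2 b (by simp)) hab
  have hp : (l'.map Prod.fst).Pairwise (· < ·) := by
    rw [← List.isChain_iff_pairwise, List.isChain_map]
    exact hchain'
  have hn : (l'.map Prod.fst).Nodup := hp.imp fun h => h.ne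
  have := hn.length_le_card
  simp [h1] at this

end leastLabel

lemma ListChain.map_congr {R α β : Type*} [CommRing R] {s : Set (List α)} {f h : α → β}
    (hfh : ∀ l ∈ s, ∀ x ∈ l, f x = h x) {c : ListChain R α} (hc : c ∈ on R s) :
    ListChain.map f c = ListChain.map h c := by
  refine sub_eq_zero.1 ((Submodule.mem_bot R).1 (apply_mem_of_forall
    (ListChain.map f - ListChain.map h) (p := ⊥) (fun l hl => ?_) hc))
  simp [List.map_congr_left (hfh l hl)]

variable {G : Type*} [Group G] [Fintype G]

/-- The labels of the points of the join determined by strict maxima of the rows of an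
equivariant map. -/
lemma exists_label {q N : ℕ} [Nonempty (Fin q × G)] (Ψ : (Fin N → G → ℝ) → (Fin q → G → ℝ))
    (hcont : ContinuousOn Ψ (joinSpace G N N))
    (hequiv : ∀ g : G, ∀ w ∈ joinSpace G N N, Ψ (g • w) = g • Ψ w)
    (hmax : ∀ w ∈ joinSpace G N N, ∃ i a, ∀ b, b ≠ a → Ψ w i b < Ψ w i a) :
    ∃ δ > 0, ∃ lab : (Fin N → G → ℝ) → Fin q × G,
      (∀ g : G, ∀ w ∈ joinSpace G N N, lab (g • w) = ((lab w).1, g * (lab w).2)) ∧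
      ∀ v ∈ joinSpace G N N, ∀ w ∈ joinSpace G N N, dist v w < δ → (lab v).1 = (lab w).1 →
        (lab v).2 = (lab w).2 := by
  classical
  set J := joinSpace G N N with hJ
  let C : Fin q × G → Set (Fin N → G → ℝ) :=
    fun p => {w | ∀ b, b ≠ p.2 → Ψ w p.1 b < Ψ w p.1 p.2}
  have hC : ∀ w ∈ J, ∃ p, w ∈ C p := fun w hw => by
    obtain ⟨i, a, h⟩ := hmax w hw
    exact ⟨(i, a), h⟩
  choose! p hp using hC
  have hnhds : ∀ w ∈ J, C (p w) ∈ 𝓝[J] w := fun w hw => by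
    have : ∀ b, b ≠ (p w).2 → ∀ᶠ v in 𝓝[J] w, Ψ v (p w).1 b < Ψ v (p w).1 (p w).2 := by
      intro b hb
      have h := fun c => ((continuous_apply_apply (p w).1 c).tendsto _).comp (hcont w hw)
      exact (h b).eventually_lt (h _) (hp w hw b hb)
    have h2 := Filter.eventually_all.2 fun b => Filter.eventually_all.2 (this b)
    exact h2
  obtain ⟨δ, hδ, hball⟩ := Metric.uniformity_basis_dist.lebesgue_number_lemma_nhdsWithin
    joinSpace.isCompact hnhds
  have hball : ∀ w ∈ J, ∃ v, Metric.ball w δ ∩ J ⊆ C (p v) := fun w hw => by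
    obtain ⟨v, hv⟩ := hball w hw
    exact ⟨v, fun u hu => hv ⟨by simpa [UniformSpace.ball, dist_comm] using hu.1, hu.2⟩⟩
  have hdisj : ∀ w i a b, w ∈ C (i, a) → w ∈ C (i, b) → a = b := fun w i a b ha hb => by
    by_contra hab
    exact lt_asymm (ha b (Ne.symm hab)) (hb a hab)
  have hCsmul : ∀ (g : G) w p, w ∈ J → w ∈ C p → g • w ∈ C (p.1, g * p.2) := by
    intro g w p hw hwp b hb
    rw [hequiv g w hw]
    simp only [regular_pi_smul_apply, inv_mul_cancel_left]
    exact hwp _ (by rwa [Ne, inv_mul_eq_iff_eq_mul])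
  let L : (Fin N → G → ℝ) → Fin q × G → Prop := fun w p =>
    Metric.ball w δ ∩ J ⊆ C p ∧ ∀ p', Metric.ball w δ ∩ J ⊆ C p' → p.1 ≤ p'.1
  have hself : ∀ w ∈ J, w ∈ Metric.ball w δ ∩ J := fun w hw => ⟨Metric.mem_ball_self hδ, hw⟩
  have hex : ∀ w ∈ J, ∃ p, L w p := fun w hw => by
    obtain ⟨v, hv⟩ := hball w hw
    obtain ⟨p, hp, hmin⟩ := Set.exists_min_image {p | Metric.ball w δ ∩ J ⊆ C p} Prod.fst
      (Set.toFinite _) ⟨_, hv⟩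
    exact ⟨p, hp, hmin⟩
  have huniq : ∀ w ∈ J, ∀ p p', L w p → L w p' → p = p' := by
    rintro w hw ⟨i, a⟩ ⟨j, b⟩ h h'
    obtain rfl : i = j := le_antisymm (h.2 _ h'.1) (h'.2 _ h.1)
    rw [hdisj w i a b (h.1 (hself w hw)) (h'.1 (hself w hw))]
  have hsub : ∀ (g : G) w p, Metric.ball w δ ∩ J ⊆ C p →
      Metric.ball (g • w) δ ∩ J ⊆ C (p.1, g * p.2) := by
    rintro g w p h u ⟨hu, huJ⟩
    have : g⁻¹ • u ∈ Metric.ball w δ ∩ J := by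
      refine ⟨?_, joinSpace.smul_mem _ huJ⟩
      rw [Metric.mem_ball] at hu ⊢
      rwa [← dist_smul g, smul_inv_smul]
    simpa using hCsmul g _ _ this.2 (h this)
  have hLsmul : ∀ (g : G) w p, L w p → L (g • w) (p.1, g * p.2) := by
    refine fun g w p h => ⟨hsub g w p h.1, fun p' hp' => ?_⟩
    have := hsub g⁻¹ _ _ hp'
    rw [inv_smul_smul] at this
    exact h.2 (p'.1, g⁻¹ * p'.2) this
  choose! lab hlab using hex
  refine ⟨δ, hδ, lab, fun g w hw => ?_, fun v hv w hw hvw hfst => ?_⟩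
  · exact huniq _ (joinSpace.smul_mem g hw) _ _ (hlab _ (joinSpace.smul_mem g hw))
      (hLsmul g w _ (hlab w hw))
  · refine hdisj v (lab v).1 _ _ ((hlab v hv).1 (hself v hv)) ?_
    rw [hfst]
    exact (hlab w hw).1 ⟨hvw, hv⟩

/-- There is no equivariant map from the `(q + 1)`-fold join of a nontrivial cyclic group to the
space of `q`-tuples of functions one of which has a strict maximum. -/
theorem joinSpace_exists_no_strict_max [Nontrivial G] {g : G}
    (gen : ∀ x, x ∈ Subgroup.zpowers g) {q : ℕ}
    (Ψ : (Fin (q + 1) → G → ℝ) → (Fin q → G → ℝ))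
    (hcont : ContinuousOn Ψ (joinSpace G (q + 1) (q + 1)))
    (hequiv : ∀ k : G, ∀ w ∈ joinSpace G (q + 1) (q + 1), Ψ (k • w) = k • Ψ w) :
    ∃ w ∈ joinSpace G (q + 1) (q + 1), ∀ i a, ∃ b, b ≠ a ∧ Ψ w i a ≤ Ψ w i b := by
  by_contra! hmax
  have : Nonempty (Fin q × G) := by
    obtain ⟨i, a, -⟩ := hmax (joinVertex 0 1) (joinSpace.joinVertex_mem (by simp) 1)
    exact ⟨(i, a)⟩
  obtain ⟨δ, hδ, lab, hlab, hadm⟩ := exists_label Ψ hcont hequiv hmax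
  let R := ZMod (orderOf g)
  have hg1 : g ≠ 1 := by
    rintro rfl
    obtain ⟨x, hx⟩ := exists_ne (1 : G)
    simpa [hx] using gen x
  have : Fact (1 < orderOf g) := ⟨by
    have := orderOf_pos g
    have := mt orderOf_eq_one_iff.1 hg1
    omega⟩
  let d : Fin q × G := lab (joinVertex 0 1)
  let μ : ℕ → (ListChain R (Fin (q + 1) → G → ℝ) →ₗ[R] ListChain R G) := fun k =>
    ListChain.map Prod.snd ∘ₗ sd (leastLabel d) k ∘ₗ ListChain.map lab
  have hlen : ∀ {k : ℕ} {c : ListChain R (Fin (q + 1) → G → ℝ)},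
      c ∈ on R (fineLists G (q + 1) (q + 1) k δ) →
      ListChain.map lab c ∈ on R {l | l.length = k} := fun hc =>
    map_mem_on (fun l hl => by simpa using hl.1) hc
  have hμbd : ∀ k, ∀ c ∈ on R (fineLists G (q + 1) (q + 1) (k + 1) δ),
      bd (μ (k + 1) c) = μ k (bd c) := by
    intro k c hc
    simp only [μ, LinearMap.comp_apply]
    rw [bd_map, bd_sd _ _ (hlen hc), ListChain.bd_map]
  have hμsmul : ∀ k, ∀ c ∈ on R (fineLists G (q + 1) (q + 1) k δ), ∀ h : G,
      μ k (ListChain.map (h • ·) c) = ListChain.map (h • ·) (μ k c) := by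
    intro k c hc h
    simp only [μ, LinearMap.comp_apply]
    rw [map_map, ListChain.map_congr (f := lab ∘ fun x => h • x)
      (h := (fun p : Fin q × G => (p.1, h * p.2)) ∘ lab)
      (fun l hl x hx => hlab h x (hl.2.1 x hx)) hc, ← map_map,
      sd_map (leastLabel d) (leastLabel d) (fun p : Fin q × G => (p.1, h * p.2))
      (fun p => (p.1, h * p.2)) (fun l hl => leastLabel_map (fun _ => rfl) hl) k (hlen hc),
      map_map, map_map]
    rfl
  obtain ⟨θ, z, hθ, hz, -, -, h1⟩ := exists_transgressive_fine gen (by simp [R]) μ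
    (by simp [μ, sd_zero_single]) hμbd hμsmul (q + 1) le_rfl hδ le_rfl
  refine zero_ne_one (α := R) (h1 ▸ ?_)
  symm
  rw [← Submodule.mem_bot R, ← LinearMap.comp_apply]
  refine apply_mem_of_forall (p := ⊥) _ (fun l hl => ?_) hz
  rw [LinearMap.comp_apply]
  refine apply_mem_of_forall (p := ⊥) _ (fun l hl => (Submodule.mem_bot R).2
    (hθ.degenerate l hl)) ?_
  simp only [μ, LinearMap.comp_apply, map_single]
  refine map_snd_sd_leastLabel_mem_degenerate (by simpa using hl.1) ?_
  simp only [List.mem_map]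
  rintro _ ⟨v, hv, rfl⟩ _ ⟨w, hw, rfl⟩
  exact hadm v (hl.2.1 v hv) w (hl.2.1 w hw) (hl.2.2 v hv w hw)

end Labelling

lemma ContinuousOn.exists_union_of_isClosed {A V : Type*} [TopologicalSpace A]
    [TopologicalSpace V] {S T : Set A} (hS : IsClosed S) (hT : IsClosed T) {f g : A → V}
    (hf : ContinuousOn f S) (hg : ContinuousOn g T) (h : EqOn f g (S ∩ T)) :
    ∃ F, ContinuousOn F (S ∪ T) ∧ EqOn F f S ∧ EqOn F g T := by
  classical
  have h1 : EqOn (S.piecewise f g) f S := fun x hx => by simp [hx]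
  have h2 : EqOn (S.piecewise f g) g T := fun x hx => by
    by_cases hxS : x ∈ S
    · simpa [hxS] using h ⟨hxS, hx⟩
    · simp [hxS]
  exact ⟨S.piecewise f g, (hf.congr h1).union_of_isClosed (hg.congr h2) hS hT, h1, h2⟩

section ExtendsInto

variable {A V : Type*} [TopologicalSpace A] [TopologicalSpace V]

/-- Every continuous map from a closed set to `U` extends continuously over `S`, with values
in `U`. -/
def ExtendsInto (S : Set A) (U : Set V) : Prop :=
  ∀ (C : Set A) (f : A → V), IsClosed C → ContinuousOn f C → MapsTo f C U →
    ∃ F, ContinuousOn F (C ∪ S) ∧ MapsTo F (C ∪ S) U ∧ EqOn F f C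

namespace ExtendsInto

variable {S T : Set A} {U : Set V}

lemma mono (h : ExtendsInto T U) (hST : S ⊆ T) : ExtendsInto S U := fun C f hC hf hfU => by
  obtain ⟨F, h1, h2, h3⟩ := h C f hC hf hfU
  have : C ∪ S ⊆ C ∪ T := union_subset_union_right C hST
  exact ⟨F, h1.mono this, h2.mono_left this, h3⟩

lemma of_subset (hS : IsClosed S)
    (h : ∀ C ⊆ S, ∀ f : A → V, IsClosed C → ContinuousOn f C → MapsTo f C U →
      ∃ F, ContinuousOn F S ∧ MapsTo F S U ∧ EqOn F f C) : ExtendsInto S U := by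
  intro C f hC hf hfU
  obtain ⟨F, h1, h2, h3⟩ := h (C ∩ S) inter_subset_right f (hC.inter hS)
    (hf.mono inter_subset_left) (hfU.mono_left inter_subset_left)
  obtain ⟨F', h1', h2', h3'⟩ := hf.exists_union_of_isClosed hC hS h1 h3.symm
  refine ⟨F', h1', ?_, h2'⟩
  rintro x (hx | hx)
  · rw [h2' hx]; exact hfU hx
  · rw [h3' hx]; exact h2 hx

lemma union (hS : IsClosed S) (h : ExtendsInto S U) (h' : ExtendsInto T U) :
    ExtendsInto (S ∪ T) U := fun C f hC hf hfU => by
  obtain ⟨F, h1, h2, h3⟩ := h C f hC hf hfU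
  obtain ⟨F', h1', h2', h3'⟩ := h' _ F (hC.union hS) h1 h2
  rw [union_assoc] at h1' h2'
  exact ⟨F', h1', h2', (h3'.mono subset_union_left).trans h3⟩

lemma iUnion {ι : Type*} [Finite ι] {S : ι → Set A} (hS : ∀ i, IsClosed (S i))
    (h : ∀ i, ExtendsInto (S i) U) : ExtendsInto (⋃ i, S i) U := by
  suffices ∀ s : Set ι, ExtendsInto (⋃ i ∈ s, S i) U by
    have := this univ
    rwa [biUnion_univ] at this
  intro s
  induction s, s.toFinite using Set.Finite.induction_on with
  | empty => exact fun C f _ hf hfU => ⟨f, by simpa using hf, by simpa using hfU, fun _ _ => rfl⟩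
  | insert _ _ ih =>
    rw [biUnion_insert]
    exact (h _).union (hS _) ih

/-- The extension property passes through injective maps on compact sets. -/
lemma of_injOn [T2Space A] {E : Type*} [TopologicalSpace E] [T2Space E] (hS : IsCompact S)
    {p : A → E} (hp : ContinuousOn p S) (hinj : InjOn p S) (h : ExtendsInto (p '' S) U) :
    ExtendsInto S U := by
  refine of_subset hS.isClosed fun C hCS f hC hf hfU => ?_
  rcases S.eq_empty_or_nonempty with rfl | hne
  · obtain rfl := subset_empty_iff.1 hCS
    exact ⟨f, by simpa using hfU⟩
  have : Nonempty A := ⟨hne.some⟩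
  have hCc : IsCompact C := hS.of_isClosed_subset hC hCS
  have hpC : IsCompact (p '' C) := hCc.image_of_continuousOn (hp.mono hCS)
  let f' : E → V := f ∘ Function.invFunOn p C
  have hf' : ∀ x ∈ C, f' (p x) = f x := fun x hx => by
    simp only [f', Function.comp_apply]
    rw [(hinj.mono hCS).leftInvOn_invFunOn hx]
  have hcont : ContinuousOn f' (p '' C) := by
    rw [continuousOn_iff_isClosed]
    intro t ht
    refine ⟨p '' (C ∩ f ⁻¹' t), ?_, ?_⟩
    · exact ((hCc.of_isClosed_subset (hf.preimage_isClosed_of_isClosed hC ht)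
        inter_subset_left).image_of_continuousOn
          (hp.mono (inter_subset_left.trans hCS))).isClosed
    · ext y
      constructor
      · rintro ⟨hy, x, hx, rfl⟩
        exact ⟨⟨x, ⟨hx, by simpa [hf' x hx] using hy⟩, rfl⟩, x, hx, rfl⟩
      · rintro ⟨⟨x, ⟨hx, hxt⟩, rfl⟩, -⟩
        exact ⟨by simpa [hf' x hx] using hxt, x, hx, rfl⟩
  have hmaps : MapsTo f' (p '' C) U := by
    rintro _ ⟨x, hx, rfl⟩
    rw [hf' x hx]
    exact hfU hx
  obtain ⟨F, h1, h2, h3⟩ := h (p '' C) f' hpC.isClosed hcont hmaps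
  have hsub : MapsTo p S (p '' C ∪ p '' S) := fun x hx => Or.inr (mem_image_of_mem p hx)
  exact ⟨F ∘ p, h1.comp hp hsub, h2.comp hsub, fun x hx => by
    rw [Function.comp_apply, h3 (mem_image_of_mem p hx), hf' x hx]⟩

end ExtendsInto

end ExtendsInto

section GeneralPosition

variable {E V W σ : Type*} [NormedAddCommGroup E] [NormedSpace ℝ E] [FiniteDimensional ℝ E]
  [NormedAddCommGroup V] [NormedSpace ℝ V] [FiniteDimensional ℝ V]
  [NormedAddCommGroup W] [NormedSpace ℝ W] [FiniteDimensional ℝ W]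

lemma exists_small_translate_ne_zero [Finite σ] {K : Set E} (hK : IsCompact K) {P : E → V}
    (hP : ContDiff ℝ 1 P) {L : σ → V →L[ℝ] W} (hL : ∀ s, Function.Surjective (L s))
    (hEW : Module.finrank ℝ E < Module.finrank ℝ W) {ε : ℝ} (hε : 0 < ε) :
    ∃ c : V, ‖c‖ < ε ∧ ∀ x ∈ K, ∀ s, L s (P x + c) ≠ 0 := by
  have := FiniteDimensional.complete ℝ V
  have := FiniteDimensional.complete ℝ W
  let B : σ → Set V := fun s => L s ⁻¹' ((fun x => -L s (P x)) '' K)ᶜ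
  have hcont : ∀ s, ContDiff ℝ 1 fun x => -L s (P x) := fun s => by fun_prop
  have hopen : ∀ s, IsOpen (B s) := fun s =>
    ((hK.image (hcont s).continuous).isClosed.isOpen_compl).preimage (L s).continuous
  have hdense : ∀ s, Dense (B s) := fun s =>
    (((hcont s).dense_compl_range_of_finrank_lt_finrank hEW).mono
      (compl_subset_compl.2 (image_subset_range _ _))).preimage ((L s).isOpenMap (hL s))
  obtain ⟨c, hcε, hc⟩ := (dense_iInter_of_isOpen hopen hdense).inter_open_nonempty
    (Metric.ball 0 ε) Metric.isOpen_ball ⟨0, Metric.mem_ball_self hε⟩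
  refine ⟨c, by simpa using hcε, fun x hx s h => mem_iInter.1 hc s ⟨x, hx, ?_⟩⟩
  rw [map_add] at h
  exact (eq_neg_of_add_eq_zero_right h).symm

lemma extendsInto_of_finrank_lt [Finite σ] [Nonempty σ] {K : Set E} (hK : IsCompact K)
    {L : σ → V →L[ℝ] W} (hL : ∀ s, Function.Surjective (L s))
    (hEW : Module.finrank ℝ E < Module.finrank ℝ W) :
    ExtendsInto K {v | ∀ s, L s v ≠ 0} := by
  refine ExtendsInto.of_subset hK.isClosed fun C hCK f hC hf hfU => ?_
  set U : Set V := {v | ∀ s, L s v ≠ 0} with hU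
  have hUo : IsOpen U := by
    simp only [hU, ofPred_forall]
    exact isOpen_iInter_of_finite fun s => isOpen_ne_fun (L s).continuous continuous_const
  have hne : Uᶜ.Nonempty := ⟨0, fun h => h (Classical.arbitrary σ) (map_zero _)⟩
  have : TietzeExtension V := TietzeExtension.of_tvs ℝ
  obtain ⟨F, hF⟩ := ContinuousMap.exists_restrict_eq hC ⟨C.domRestrict f, hf.domRestrict⟩
  have hFf : EqOn F f C := fun x hx => DFunLike.congr_fun hF ⟨x, hx⟩
  have hρ : Continuous fun x => Metric.infDist (F x) Uᶜ :=
    (Metric.continuous_infDist_pt _).comp F.continuous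
  obtain ⟨ε, hε, hεC⟩ : ∃ ε > 0, ∀ x ∈ C, ε < Metric.infDist (F x) Uᶜ := by
    rcases C.eq_empty_or_nonempty with rfl | hCne
    · exact ⟨1, one_pos, by simp⟩
    obtain ⟨x, hx, hmin⟩ :=
      (hK.of_isClosed_subset hC hCK).exists_isMinOn hCne hρ.continuousOn
    have hpos : 0 < Metric.infDist (F x) Uᶜ := by
      rw [← hUo.isClosed_compl.notMem_iff_infDist_pos hne, hFf hx]
      exact fun h => h (hfU hx)
    refine ⟨_, half_pos hpos, fun y hy => (half_lt_self hpos).trans_le (hmin hy)⟩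
  obtain ⟨P, hP, hPF, -⟩ := F.continuous.exists_contDiff_approx 1 (ε := fun _ => ε / 2)
    continuous_const fun _ => half_pos hε
  obtain ⟨c, hcε, hc⟩ := exists_small_translate_ne_zero hK hP hL hEW (half_pos hε)
  have hnear : ∀ x, ‖P x + c - F x‖ < ε := fun x => by
    have h1 := hPF x
    rw [dist_eq_norm] at h1
    have : P x + c - F x = (P x - F x) + c := by abel
    rw [this]
    exact (norm_add_le _ _).trans_lt (by linarith)
  obtain ⟨χ, hχ0, hχ1, hχ⟩ := exists_continuous_zero_one_of_isClosed
    (s := {x | Metric.infDist (F x) Uᶜ ≤ ε}) (t := C) (isClosed_le hρ continuous_const) hC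
    (disjoint_left.2 fun x hx hxC => (hεC x hxC).not_ge hx)
  refine ⟨fun x => P x + c + χ x • (F x - (P x + c)), ?_, fun x hx => ?_, fun x hx => ?_⟩
  · have := hP.continuous
    fun_prop
  · by_cases hxε : Metric.infDist (F x) Uᶜ ≤ ε
    · have : χ x = 0 := hχ0 hxε
      simp only [this, zero_smul, add_zero]
      exact hc x hx
    · by_contra hxU
      have h1 := Metric.infDist_le_dist_of_mem (x := F x) (mem_compl hxU)
      have h2 : F x - (P x + c + χ x • (F x - (P x + c))) =
          (χ x - 1) • (P x + c - F x) := by module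
      rw [dist_eq_norm, h2, norm_smul] at h1
      have h3 : ‖χ x - 1‖ ≤ 1 := by
        rw [Real.norm_eq_abs, abs_le]
        constructor <;> linarith [(hχ x).1, (hχ x).2]
      have := hnear x
      nlinarith [norm_nonneg (P x + c - F x), norm_nonneg (χ x - 1)]
  · have : χ x = 1 := hχ1 hx
    simp [this, hFf hx]

end GeneralPosition

section Retract

universe u v

variable {A : Type u} {V : Type v} [TopologicalSpace A] [TopologicalSpace V]

lemma ExtendsInto.retract {Y : Type*} [TopologicalSpace Y] {S : Set A} {U : Set V} {U' : Set Y}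
    (h : ExtendsInto S U) {ι : Y → V} {ρ : V → Y} (hι : ContinuousOn ι U')
    (hρ : ContinuousOn ρ U) (hιU : MapsTo ι U' U) (hρU : MapsTo ρ U U')
    (hρι : ∀ y ∈ U', ρ (ι y) = y) : ExtendsInto S U' := fun C f hC hf hfU => by
  obtain ⟨F, h1, h2, h3⟩ := h C (ι ∘ f) hC (hι.comp hf hfU) (hιU.comp hfU)
  refine ⟨ρ ∘ F, hρ.comp h1 h2, hρU.comp h2, fun x hx => ?_⟩
  rw [Function.comp_apply, h3 hx, Function.comp_apply, hρι _ (hfU hx)]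

lemma extendsInto_univ [NormalSpace A] [TietzeExtension.{u, v} V] (S : Set A) :
    ExtendsInto S (univ : Set V) := fun C f hC hf _ => by
  obtain ⟨F, hF⟩ := ContinuousMap.exists_restrict_eq hC ⟨C.domRestrict f, hf.domRestrict⟩
  exact ⟨F, F.continuous.continuousOn, mapsTo_univ _ _,
    fun x hx => DFunLike.congr_fun hF ⟨x, hx⟩⟩

variable {E : Type*} [NormedAddCommGroup E] [NormedSpace ℝ E]

lemma ExtendsInto.sphere {S : Set A} (h : ExtendsInto S ({0}ᶜ : Set E)) :
    ExtendsInto S (univ : Set (Metric.sphere (0 : E) 1)) := by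
  rcases isEmpty_or_nonempty (Metric.sphere (0 : E) 1) with hem | ⟨⟨e⟩⟩
  · intro C f hC hf _
    refine ⟨f, ?_, mapsTo_univ _ _, fun _ _ => rfl⟩
    exact fun x => (hem.false (f x)).elim
  classical
  let ρ : E → Metric.sphere (0 : E) 1 := fun v =>
    if hv : v = 0 then e else ⟨‖v‖⁻¹ • v, by simp [norm_smul, hv]⟩
  have hρ : ∀ v ≠ 0, (ρ v : E) = ‖v‖⁻¹ • v := fun v hv => by simp [ρ, hv]
  refine h.retract (ι := Subtype.val) (ρ := ρ) continuous_subtype_val.continuousOn ?_ ?_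
    (mapsTo_univ _ _) ?_
  · rw [continuousOn_iff_continuous_domRestrict, continuous_induced_rng]
    have : Subtype.val ∘ ({0}ᶜ : Set E).domRestrict ρ =
        ({0}ᶜ : Set E).domRestrict fun v => ‖v‖⁻¹ • v := funext fun v => hρ v v.2
    rw [this, ← continuousOn_iff_continuous_domRestrict]
    exact (continuousOn_id.norm.inv₀ fun v hv => norm_ne_zero_iff.2 hv).smul continuousOn_id
  · intro y _
    exact ne_zero_of_mem_unit_sphere y
  · intro y _
    ext1
    rw [hρ _ (ne_zero_of_mem_unit_sphere y)]
    simp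

lemma extendsInto_closedBall [NormalSpace A] [FiniteDimensional ℝ E] (S : Set A) :
    ExtendsInto S (Metric.closedBall (0 : E) 1) := by
  have : TietzeExtension.{u, _} E := TietzeExtension.of_tvs ℝ
  have hpos : ∀ v : E, 0 < max 1 ‖v‖ := fun v => lt_max_of_lt_left one_pos
  refine (extendsInto_univ (V := E) S).retract (ι := id) (ρ := fun v => (max 1 ‖v‖)⁻¹ • v)
    continuousOn_id ?_ (mapsTo_univ _ _) (fun v _ => ?_) (fun v hv => ?_)
  · exact (Continuous.smul ((continuous_const.max continuous_norm).inv₀ fun v => (hpos v).ne')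
      continuous_id).continuousOn
  · rw [mem_closedBall_zero_iff, norm_smul, norm_inv, Real.norm_of_nonneg (hpos v).le,
      inv_mul_le_one₀ (hpos v)]
    exact le_max_right _ _
  · rw [mem_closedBall_zero_iff] at hv
    simp [max_eq_left hv]

lemma extendsInto_compl_singleton_sphere [NormalSpace A] {n : ℕ} (S : Set A)
    (y : Metric.sphere (0 : EuclideanSpace ℝ (Fin (n + 1))) 1) :
    ExtendsInto S ({y}ᶜ : Set (Metric.sphere (0 : EuclideanSpace ℝ (Fin (n + 1))) 1)) := by
  have : Fact (Module.finrank ℝ (EuclideanSpace ℝ (Fin (n + 1))) = n + 1) := ⟨by simp⟩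
  let φ := stereographic' n y
  have hs : φ.source = {y}ᶜ := stereographic'_source y
  have ht : φ.target = univ := stereographic'_target y
  have : TietzeExtension.{u, _} (EuclideanSpace ℝ (Fin n)) := TietzeExtension.of_tvs ℝ
  refine (extendsInto_univ (V := EuclideanSpace ℝ (Fin n)) S).retract (ι := φ) (ρ := φ.symm)
    ?_ ?_ (mapsTo_univ _ _) ?_ ?_
  · rw [← hs]; exact φ.continuousOn
  · rw [← ht]; exact φ.continuousOn_symm
  · rw [← hs, ← ht]; exact φ.mapsTo_symm
  · intro z hz
    rw [← hs] at hz
    exact φ.left_inv hz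

end Retract

section Equivariant

variable {Γ P Q : Type*} [Group Γ] [Finite Γ] [TopologicalSpace P] [TopologicalSpace Q]
  [MulAction Γ P] [MulAction Γ Q] [ContinuousConstSMul Γ P] [ContinuousConstSMul Γ Q]

lemma exists_equivariant_glue {A B : Set P} {Y : Set Q} (hA : IsClosed A) (hB : IsClosed B)
    (hBinv : ∀ g : Γ, ∀ x ∈ B, g • x ∈ B) (hYinv : ∀ g : Γ, ∀ y ∈ Y, g • y ∈ Y)
    (hAB : ∀ g : Γ, g ≠ 1 → ∀ x ∈ A, g • x ∈ A → x ∈ B)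
    {F F' : P → Q} (hF : ContinuousOn F B) (hFeq : ∀ g : Γ, ∀ x ∈ B, F (g • x) = g • F x)
    (hFY : MapsTo F B Y) (hF' : ContinuousOn F' A) (hF'Y : MapsTo F' A Y)
    (hFF' : ∀ x ∈ A, x ∈ B → F' x = F x) :
    ∃ H : P → Q, ContinuousOn H (B ∪ ⋃ g : Γ, (g • ·) ⁻¹' A) ∧
      (∀ g : Γ, ∀ x ∈ B ∪ ⋃ g : Γ, (g • ·) ⁻¹' A, H (g • x) = g • H x) ∧
      MapsTo H (B ∪ ⋃ g : Γ, (g • ·) ⁻¹' A) Y := by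
  classical
  let H : P → Q := fun x =>
    if x ∈ B then F x else if h : ∃ g : Γ, g • x ∈ A then h.choose⁻¹ • F' (h.choose • x) else F x
  have hHB : EqOn H F B := fun x hx => by simp [H, hx]
  have hHA : ∀ (g : Γ) x, g • x ∈ A → H x = g⁻¹ • F' (g • x) := by
    intro g x hgx
    by_cases hx : x ∈ B
    · rw [hHB hx, hFF' _ hgx (hBinv g x hx), hFeq g x hx, inv_smul_smul]
    · have h : ∃ g : Γ, g • x ∈ A := ⟨g, hgx⟩
      have hgg : h.choose = g := by
        by_contra hne
        refine hx ?_
        have := hAB (g * h.choose⁻¹) (by rwa [Ne, mul_inv_eq_one, eq_comm]) (h.choose • x)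
          h.choose_spec (by rwa [mul_smul, inv_smul_smul])
        simpa using hBinv h.choose⁻¹ _ this
      simp only [H, if_neg hx, dif_pos h]
      rw [hgg]
  refine ⟨H, ?_, ?_, ?_⟩
  · refine (hF.congr hHB).union_of_isClosed ?_ hB
      (isClosed_iUnion_of_finite fun g => hA.preimage (continuous_const_smul g))
    refine (locallyFinite_of_finite _).continuousOn_iUnion
      (fun g => hA.preimage (continuous_const_smul g)) fun g => ?_
    refine ContinuousOn.congr (f := fun x => g⁻¹ • F' (g • x)) ?_ fun x hx => hHA g x hx
    exact (hF'.comp (continuous_const_smul g).continuousOn fun x hx => hx).const_smul g⁻¹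
  · rintro g x (hx | hx)
    · rw [hHB hx, hHB (hBinv g x hx), hFeq g x hx]
    · obtain ⟨k, hk⟩ := mem_iUnion.1 hx
      have hk : k • x ∈ A := hk
      rw [hHA k x hk, hHA (k * g⁻¹) (g • x) (by rwa [mul_smul, inv_smul_smul])]
      simp [mul_smul]
  · rintro x (hx | hx)
    · rw [hHB hx]; exact hFY hx
    · obtain ⟨k, hk⟩ := mem_iUnion.1 hx
      have hk : k • x ∈ A := hk
      rw [hHA k x hk]
      exact hYinv _ _ (hF'Y hk)

/-- A compact free space has an equivariant map to an invariant set into which maps extend. -/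
lemma exists_equivariant_of_extendsInto [CompactSpace P] [T2Space P] [Nonempty Q]
    (hfree : ∀ g : Γ, g ≠ 1 → ∀ x : P, g • x ≠ x) {U : Set Q}
    (hU : ∀ g : Γ, ∀ y ∈ U, g • y ∈ U) (hext : ExtendsInto (univ : Set P) U) :
    ∃ F : P → Q, Continuous F ∧ (∀ (g : Γ) x, F (g • x) = g • F x) ∧ ∀ x, F x ∈ U := by
  classical
  have hnhds : ∀ x : P, ∃ A ∈ 𝓝 x, IsClosed A ∧ ∀ g : Γ, g ≠ 1 → ∀ y ∈ A, g • y ∉ A := by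
    intro x
    have h : ∀ᶠ p in 𝓝 x ×ˢ 𝓝 x, ∀ g : Γ, g ≠ 1 → g • p.1 ≠ p.2 := by
      rw [← nhds_prod_eq]
      refine Filter.eventually_all.2 fun g => Filter.eventually_all.2 fun hg => ?_
      exact (isOpen_ne_fun (by fun_prop) (by fun_prop)).mem_nhds (hfree g hg x)
    obtain ⟨t, ht, h⟩ := Filter.eventually_prod_self_iff
      (r := fun y z => ∀ g : Γ, g ≠ 1 → g • y ≠ z) |>.1 h
    obtain ⟨A, hA, hAc, hAt⟩ := exists_mem_nhds_isClosed_subset ht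
    exact ⟨A, hA, hAc, fun g hg y hy hgy => h y (hAt hy) _ (hAt hgy) g hg rfl⟩
  choose A hAn hAc hAfree using hnhds
  have key : ∀ t : Finset P, ∃ B : Set P, IsClosed B ∧ (∀ g : Γ, ∀ x ∈ B, g • x ∈ B) ∧
      (∀ x ∈ t, A x ⊆ B) ∧ ∃ F : P → Q, ContinuousOn F B ∧
        (∀ g : Γ, ∀ x ∈ B, F (g • x) = g • F x) ∧ MapsTo F B U := by
    intro t
    induction t using Finset.induction_on with
    | empty => exact ⟨∅, by simp, by simp, by simp, fun _ => Classical.arbitrary Q, by simp,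
        by simp, mapsTo_empty _ _⟩
    | insert x t _ ih =>
      obtain ⟨B, hB, hBinv, htB, F, hF, hFeq, hFU⟩ := ih
      obtain ⟨F', hF', hF'U, hFF'⟩ := hext.mono (subset_univ (A x)) B F hB hF hFU
      obtain ⟨H, h1, h2, h3⟩ := exists_equivariant_glue (hAc x) hB hBinv hU
        (fun g hg y hy hgy => (hAfree x g hg y hy hgy).elim) hF hFeq hFU
        (hF'.mono subset_union_right) (hF'U.mono_left subset_union_right)
        (fun y _ hy => hFF' hy)
      refine ⟨_, hB.union (isClosed_iUnion_of_finite fun g : Γ =>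
        (hAc x).preimage (continuous_const_smul g)), ?_, ?_, H, h1, h2, h3⟩
      · rintro g y (hy | hy)
        · exact Or.inl (hBinv g y hy)
        · obtain ⟨k, hk⟩ := mem_iUnion.1 hy
          exact Or.inr (mem_iUnion.2 ⟨k * g⁻¹, by simpa [mul_smul] using hk⟩)
      · intro z hz
        rcases Finset.mem_insert.1 hz with rfl | hz
        · exact fun y hy => Or.inr (mem_iUnion.2 ⟨1, by simpa using hy⟩)
        · exact (htB z hz).trans subset_union_left
  obtain ⟨t, -, ht⟩ := isCompact_univ.elim_nhds_subcover A fun x _ => hAn x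
  obtain ⟨B, -, -, htB, F, hF, hFeq, hFU⟩ := key t
  have hBu : B = univ := univ_subset_iff.1 (ht.trans (iUnion₂_subset htB))
  subst hBu
  exact ⟨F, continuousOn_univ.1 hF, fun g x => hFeq g x trivial, fun x => hFU trivial⟩

end Equivariant

section JoinMaps

attribute [local instance] regularMulAction

variable {G : Type*} [Group G] [Fintype G] {N : ℕ}

variable (G) in
/-- The cone over `joinSpace G N i` with apex the vertex with coordinates `i`, `1`. -/
def joinCone (i : Fin N) : Set (Fin N → G → ℝ) :=
  {w | w ∈ joinSpace G N (i + 1) ∧ ∀ a, a ≠ 1 → w i a = 0}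

lemma isClosed_joinCone (i : Fin N) : IsClosed (joinCone G i) := by
  simp only [joinCone, ofPred_and, ofPred_forall]
  exact joinSpace.isClosed.inter (isClosed_iInter fun a => isClosed_iInter fun _ =>
    isClosed_eq (by fun_prop) continuous_const)

lemma joinSpace.mem_of_row_eq_zero {i : Fin N} {w : Fin N → G → ℝ}
    (hw : w ∈ joinSpace G N (i + 1)) (h : w i = 0) : w ∈ joinSpace G N i := by
  refine ⟨hw.1, hw.2.1, fun j hj => ?_, hw.2.2.2⟩
  rcases hj.eq_or_lt with hj | hj
  · rwa [← Fin.ext hj]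
  · exact hw.2.2.1 j hj

lemma mem_joinSpace_of_smul_mem_joinCone {i : Fin N} {g : G} (hg : g ≠ 1) {w : Fin N → G → ℝ}
    (hw : w ∈ joinCone G i) (hgw : g • w ∈ joinCone G i) : w ∈ joinSpace G N i := by
  refine joinSpace.mem_of_row_eq_zero hw.1 (funext fun a => ?_)
  by_cases ha : a = 1
  · have := hgw.2 g hg
    rwa [regular_pi_smul_apply, inv_mul_cancel, ← ha] at this
  · exact hw.2 a ha

lemma exists_smul_mem_joinCone {i : Fin N} {w : Fin N → G → ℝ}
    (hw : w ∈ joinSpace G N (i + 1)) : ∃ g : G, g • w ∈ joinCone G i := by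
  by_cases h : ∃ a, w i a ≠ 0
  · obtain ⟨a, ha⟩ := h
    refine ⟨a⁻¹, joinSpace.smul_mem _ hw, fun b hb => ?_⟩
    rw [regular_pi_smul_apply, inv_inv]
    exact (mul_eq_zero.1 (hw.2.1 i a (a * b) (by simpa using hb))).resolve_left ha
  · push Not at h
    exact ⟨1, joinSpace.smul_mem _ hw, fun b _ => by rw [one_smul, h b]⟩

variable {Q : Type*} [TopologicalSpace Q] [MulAction G Q] [ContinuousConstSMul G Q]

lemma joinSpace.exists_equivariant_extension {i : Fin N} {Y : Set Q}
    (hYinv : ∀ g : G, ∀ y ∈ Y, g • y ∈ Y) {F F' : (Fin N → G → ℝ) → Q}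
    (hF : ContinuousOn F (joinSpace G N i))
    (hFeq : ∀ g : G, ∀ w ∈ joinSpace G N i, F (g • w) = g • F w)
    (hFY : MapsTo F (joinSpace G N i) Y) (hF' : ContinuousOn F' (joinCone G i))
    (hF'Y : MapsTo F' (joinCone G i) Y) (hFF' : EqOn F' F (joinSpace G N i)) :
    ∃ H : (Fin N → G → ℝ) → Q, ContinuousOn H (joinSpace G N (i + 1)) ∧
      (∀ g : G, ∀ w ∈ joinSpace G N (i + 1), H (g • w) = g • H w) ∧
      MapsTo H (joinSpace G N (i + 1)) Y := by
  obtain ⟨H, h1, h2, h3⟩ := exists_equivariant_glue (isClosed_joinCone i) joinSpace.isClosed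
    (fun g w hw => joinSpace.smul_mem g hw) hYinv
    (fun g hg w hw hgw => mem_joinSpace_of_smul_mem_joinCone hg hw hgw) hF hFeq hFY hF' hF'Y
    (fun w _ hw => hFF' hw)
  have hsub : joinSpace G N (i + 1) ⊆
      joinSpace G N i ∪ ⋃ g : G, (g • ·) ⁻¹' joinCone G i := fun w hw =>
    Or.inr (mem_iUnion.2 (exists_smul_mem_joinCone hw))
  exact ⟨H, h1.mono hsub, fun g w hw => h2 g w (hsub hw), h3.mono_left hsub⟩

lemma joinSpace.exists_equivariant_of_extendsInto {i : Fin N} {Y : Set Q}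
    (hYinv : ∀ g : G, ∀ y ∈ Y, g • y ∈ Y) (hext : ExtendsInto (joinCone G i) Y)
    {F : (Fin N → G → ℝ) → Q} (hF : ContinuousOn F (joinSpace G N i))
    (hFeq : ∀ g : G, ∀ w ∈ joinSpace G N i, F (g • w) = g • F w)
    (hFY : MapsTo F (joinSpace G N i) Y) :
    ∃ H : (Fin N → G → ℝ) → Q, ContinuousOn H (joinSpace G N (i + 1)) ∧
      (∀ g : G, ∀ w ∈ joinSpace G N (i + 1), H (g • w) = g • H w) ∧
      MapsTo H (joinSpace G N (i + 1)) Y := by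
  obtain ⟨F', h1, h2, h3⟩ := hext _ F joinSpace.isClosed hF hFY
  exact joinSpace.exists_equivariant_extension hYinv hF hFeq hFY (h1.mono subset_union_right)
    (h2.mono_left subset_union_right) h3

/-- A join of dimension `r` extends into punctured Euclidean spaces of dimension above `r`. -/
lemma extendsInto_joinSpace {r n : ℕ} (hr : r < N) (hn : r < n) :
    ExtendsInto (joinSpace G N (r + 1)) ({0}ᶜ : Set (EuclideanSpace ℝ (Fin n))) := by
  let S : (Fin N → G) → Set (Fin N → G → ℝ) := fun h =>
    {w | w ∈ joinSpace G N (r + 1) ∧ ∀ i a, a ≠ h i → w i a = 0}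
  have hS : ∀ h, IsClosed (S h) := fun h => by
    simp only [S, ofPred_and, ofPred_forall]
    exact joinSpace.isClosed.inter (isClosed_iInter fun i => isClosed_iInter fun a =>
      isClosed_iInter fun _ => isClosed_eq (by fun_prop) continuous_const)
  have hcover : joinSpace G N (r + 1) ⊆ ⋃ h, S h := fun w hw => by
    have : ∀ i, ∃ a, ∀ b, b ≠ a → w i b = 0 := fun i => by
      by_cases h : ∃ a, w i a ≠ 0
      · obtain ⟨a, ha⟩ := h
        exact ⟨a, fun b hb => (mul_eq_zero.1 (hw.2.1 i a b hb.symm)).resolve_left ha⟩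
      · push Not at h
        exact ⟨1, fun b _ => h b⟩
    choose h hh using this
    exact mem_iUnion.2 ⟨h, hw, hh⟩
  refine (ExtendsInto.iUnion hS fun h => ?_).mono hcover
  have hcomp : IsCompact (S h) := joinSpace.isCompact.of_isClosed_subset (hS h) fun w hw => hw.1
  let p : (Fin N → G → ℝ) → EuclideanSpace ℝ (Fin r) := fun w =>
    WithLp.toLp 2 fun j => w (Fin.castLE hr.le j) (h (Fin.castLE hr.le j))
  have hp : Continuous p := by fun_prop
  refine ExtendsInto.of_injOn hcomp hp.continuousOn (fun v hv w hw hvw => ?_) ?_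
  · have hrow : ∀ i : Fin N, i ≠ ⟨r, hr⟩ → v i (h i) = w i (h i) := fun i hi => by
      rcases lt_or_ge (i : ℕ) r with hir | hir
      · have := congrArg (fun u : EuclideanSpace ℝ (Fin r) => u ⟨i, hir⟩) hvw
        exact this
      · have : r + 1 ≤ (i : ℕ) := by
          have : (i : ℕ) ≠ r := fun h => hi (Fin.ext h)
          omega
        rw [hv.1.2.2.1 i this, hw.1.2.2.1 i this]
    have hsum : ∀ u ∈ S h, ∑ i, u i (h i) = 1 := fun u hu => by
      rw [← hu.1.2.2.2]
      exact Finset.sum_congr rfl fun i _ =>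
        (Finset.sum_eq_single (h i) (fun a _ ha => hu.2 i a ha) (by simp)).symm
    have hlast : v ⟨r, hr⟩ (h ⟨r, hr⟩) = w ⟨r, hr⟩ (h ⟨r, hr⟩) := by
      have h1 := (hsum v hv).trans (hsum w hw).symm
      rw [← Finset.add_sum_erase _ _ (Finset.mem_univ (⟨r, hr⟩ : Fin N)),
        ← Finset.add_sum_erase _ _ (Finset.mem_univ (⟨r, hr⟩ : Fin N)),
        Finset.sum_congr rfl fun i hi => hrow i (Finset.ne_of_mem_erase hi)] at h1
      exact add_right_cancel h1
    funext i a
    by_cases ha : a = h i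
    · subst ha
      by_cases hi : i = ⟨r, hr⟩
      · subst hi; exact hlast
      · exact hrow i hi
    · rw [hv.2 i a ha, hw.2 i a ha]
  · have := extendsInto_of_finrank_lt (σ := Unit) (hcomp.image hp)
      (L := fun _ => ContinuousLinearMap.id ℝ (EuclideanSpace ℝ (Fin n)))
      (fun _ => Function.surjective_id) (by simpa using hn)
    have hset : ({0}ᶜ : Set (EuclideanSpace ℝ (Fin n))) =
        {v | Unit → ContinuousLinearMap.id ℝ (EuclideanSpace ℝ (Fin n)) v ≠ 0} := by
      ext v
      simp
    rw [hset]
    exact this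

lemma joinSpace.exists_equivariant_sphere {n : ℕ}
    [MulAction G (Metric.sphere (0 : EuclideanSpace ℝ (Fin (n + 1))) 1)]
    [ContinuousConstSMul G (Metric.sphere (0 : EuclideanSpace ℝ (Fin (n + 1))) 1)] (r : ℕ)
    (hrN : r ≤ N) (hrn : r ≤ n + 1) :
    ∃ F : (Fin N → G → ℝ) → Metric.sphere (0 : EuclideanSpace ℝ (Fin (n + 1))) 1,
      ContinuousOn F (joinSpace G N r) ∧ ∀ g : G, ∀ w ∈ joinSpace G N r, F (g • w) = g • F w := by
  induction r with
  | zero =>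
    have : Nonempty (Metric.sphere (0 : EuclideanSpace ℝ (Fin (n + 1))) 1) :=
      (NormedSpace.sphere_nonempty.2 zero_le_one).to_subtype
    exact ⟨fun _ => Classical.arbitrary _, by simp [joinSpace.zero_eq_empty]⟩
  | succ r ih =>
    obtain ⟨F, hF, hFeq⟩ := ih (by omega) (by omega)
    have hext := ((extendsInto_joinSpace (G := G) (r := r) (n := n + 1) (N := N)
      (by omega) (by omega)).sphere).mono (S := joinCone G ⟨r, hrN⟩) fun w hw => hw.1
    obtain ⟨H, h1, h2, -⟩ := joinSpace.exists_equivariant_of_extendsInto (i := ⟨r, hrN⟩)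
      (fun _ _ _ => mem_univ _) hext hF hFeq (mapsTo_univ _ _)
    exact ⟨H, h1, h2⟩

end JoinMaps

section SphereMap

/-- Spheres extend into complements of finitely many subspaces of large codimension. -/
lemma extendsInto_univ_sphere {n : ℕ} {V W σ : Type*} [NormedAddCommGroup V] [NormedSpace ℝ V]
    [FiniteDimensional ℝ V] [NormedAddCommGroup W] [NormedSpace ℝ W] [FiniteDimensional ℝ W]
    [Finite σ] [Nonempty σ] {L : σ → V →L[ℝ] W} (hL : ∀ s, Function.Surjective (L s))
    (hn : n < Module.finrank ℝ W) :
    ExtendsInto (univ : Set (Metric.sphere (0 : EuclideanSpace ℝ (Fin (n + 1))) 1))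
      {v | ∀ s, L s v ≠ 0} := by
  let X := Metric.sphere (0 : EuclideanSpace ℝ (Fin (n + 1))) 1
  let p : X → EuclideanSpace ℝ (Fin n) := fun x => WithLp.toLp 2 fun j => x.1 j.succ
  have hp : Continuous p := by fun_prop
  have hsq : ∀ x y : X, p x = p y → x.1 0 ^ 2 = y.1 0 ^ 2 := fun x y hxy => by
    have hnorm : ∀ z : X, z.1 0 ^ 2 + ∑ j : Fin n, z.1 j.succ ^ 2 = 1 := fun z => by
      rw [← Fin.sum_univ_succ (fun i => z.1 i ^ 2)]
      have := EuclideanSpace.norm_sq_eq z.1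
      simpa using this.symm
    have hx := hnorm x
    have hj : ∀ j : Fin n, x.1 j.succ = y.1 j.succ := fun j =>
      congrArg (fun u : EuclideanSpace ℝ (Fin n) => u j) hxy
    simp only [hj] at hx
    linarith [hnorm y]
  have heq : ∀ x y : X, p x = p y → x.1 0 = y.1 0 → x = y := fun x y hxy h0 => by
    refine Subtype.ext (PiLp.ext fun i => ?_)
    refine Fin.cases h0 (fun j => ?_) i
    exact congrArg (fun u : EuclideanSpace ℝ (Fin n) => u j) hxy
  have key : ∀ S : Set X, IsClosed S → (InjOn p S) → ExtendsInto S {v | ∀ s, L s v ≠ 0} :=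
    fun S hS hinj => ExtendsInto.of_injOn hS.isCompact hp.continuousOn hinj
      (extendsInto_of_finrank_lt (hS.isCompact.image hp) hL (by simpa using hn))
  have hc : Continuous fun x : X => x.1 0 := by fun_prop
  have hpos : IsClosed {x : X | 0 ≤ x.1 0} := isClosed_le continuous_const hc
  have hneg : IsClosed {x : X | x.1 0 ≤ 0} := isClosed_le hc continuous_const
  refine (ExtendsInto.union hpos (key _ hpos fun x hx y hy hxy => ?_)
    (key _ hneg fun x hx y hy hxy => ?_)).mono fun x _ => le_total 0 (x.1 0)
  · exact heq x y hxy ((sq_eq_sq₀ hx hy).1 (hsq x y hxy))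
  · refine heq x y hxy (neg_inj.1 ((sq_eq_sq₀ (neg_nonneg.2 hx) (neg_nonneg.2 hy)).1 ?_))
    rw [neg_sq, neg_sq]
    exact hsq x y hxy

attribute [local instance] regularMulAction

variable {G : Type*} [Group G] [Fintype G] [Nontrivial G]

/-- A free `n`-sphere has an equivariant map to `n + 1` regular representations in which some
row always attains its maximum only once. -/
lemma exists_equivariant_strict_max {n : ℕ}
    [MulAction G (Metric.sphere (0 : EuclideanSpace ℝ (Fin (n + 1))) 1)]
    [ContinuousConstSMul G (Metric.sphere (0 : EuclideanSpace ℝ (Fin (n + 1))) 1)]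
    (hfree : ∀ g : G, g ≠ 1 →
      ∀ x : Metric.sphere (0 : EuclideanSpace ℝ (Fin (n + 1))) 1, g • x ≠ x) :
    ∃ F : Metric.sphere (0 : EuclideanSpace ℝ (Fin (n + 1))) 1 → Fin (n + 1) → G → ℝ,
      Continuous F ∧ (∀ (g : G) x, F (g • x) = g • F x) ∧
      ∀ x, ∃ i a, ∀ b, b ≠ a → F x i b < F x i a := by
  let σ := {s : (Fin (n + 1) → G) × (Fin (n + 1) → G) // ∀ i, s.1 i ≠ s.2 i}
  have : Nonempty σ := by
    obtain ⟨g, hg⟩ := exists_ne (1 : G)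
    exact ⟨⟨(fun _ => g, fun _ => 1), fun _ => hg⟩⟩
  let pr : G → (G → ℝ) →L[ℝ] ℝ := fun a => ContinuousLinearMap.proj a
  let L : σ → (Fin (n + 1) → G → ℝ) →L[ℝ] (Fin (n + 1) → ℝ) := fun s =>
    ContinuousLinearMap.pi fun i =>
      (pr (s.1.1 i) - pr (s.1.2 i)) ∘L ContinuousLinearMap.proj i
  have hLa : ∀ s v i, L s v i = v i (s.1.1 i) - v i (s.1.2 i) := fun s v i => rfl
  have hL : ∀ s, Function.Surjective (L s) := fun s u => by
    classical
    refine ⟨fun i => Pi.single (s.1.1 i) (u i), funext fun i => ?_⟩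
    rw [hLa, Pi.single_eq_same, Pi.single_eq_of_ne (s.2 i).symm, sub_zero]
  have hU : ∀ g : G, ∀ v ∈ {v | ∀ s, L s v ≠ 0}, g • v ∈ {v | ∀ s, L s v ≠ 0} := by
    intro g v hv s hs
    refine hv ⟨(fun i => g⁻¹ * s.1.1 i, fun i => g⁻¹ * s.1.2 i),
      fun i h => s.2 i (mul_left_cancel h)⟩ ?_
    exact hs
  obtain ⟨F, hF, hFeq, hFU⟩ := exists_equivariant_of_extendsInto hfree hU
    (extendsInto_univ_sphere (n := n) hL (by simp))
  refine ⟨F, hF, hFeq, fun x => ?_⟩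
  by_contra! hmax
  choose a ha using fun i => Finite.exists_max (F x i)
  choose b hb hab using fun i => hmax i (a i)
  refine hFU x ⟨(a, b), fun i => (hb i).symm⟩ (funext fun i => ?_)
  rw [hLa]
  exact sub_eq_zero.2 ((hab i).antisymm (ha i (b i)))

/-- A free `n`-sphere of a cyclic group admits no equivariant map from a join of `n + 2` copies
of the group. -/
lemma not_exists_equivariant_joinSpace_sphere {n : ℕ} {g : G}
    (gen : ∀ x, x ∈ Subgroup.zpowers g)
    [MulAction G (Metric.sphere (0 : EuclideanSpace ℝ (Fin (n + 1))) 1)]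
    [ContinuousConstSMul G (Metric.sphere (0 : EuclideanSpace ℝ (Fin (n + 1))) 1)]
    (hfree : ∀ g : G, g ≠ 1 →
      ∀ x : Metric.sphere (0 : EuclideanSpace ℝ (Fin (n + 1))) 1, g • x ≠ x)
    {Φ : (Fin (n + 2) → G → ℝ) → Metric.sphere (0 : EuclideanSpace ℝ (Fin (n + 1))) 1}
    (hΦ : ContinuousOn Φ (joinSpace G (n + 2) (n + 2))) :
    ¬ ∀ k : G, ∀ w ∈ joinSpace G (n + 2) (n + 2), Φ (k • w) = k • Φ w := by
  intro hΦeq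
  obtain ⟨F, hF, hFeq, hFmax⟩ := exists_equivariant_strict_max hfree
  obtain ⟨w, -, hw⟩ := joinSpace_exists_no_strict_max gen (F ∘ Φ) (hF.comp_continuousOn hΦ)
    fun k w hw => by rw [Function.comp_apply, hΦeq k w hw, hFeq, Function.comp_apply]
  obtain ⟨i, a, hia⟩ := hFmax (Φ w)
  obtain ⟨b, hba, hb⟩ := hw i a
  exact (hia b hba).not_ge hb

lemma cyclic_image_of_ball_meets_orbit {d : ℕ} {g : G} (gen : ∀ x, x ∈ Subgroup.zpowers g)
    [MulAction G (Metric.sphere (0 : EuclideanSpace ℝ (Fin (d + 1))) 1)]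
    [ContinuousConstSMul G (Metric.sphere (0 : EuclideanSpace ℝ (Fin (d + 1))) 1)]
    [MulAction G (Metric.sphere (0 : EuclideanSpace ℝ (Fin (d + 2))) 1)]
    [ContinuousConstSMul G (Metric.sphere (0 : EuclideanSpace ℝ (Fin (d + 2))) 1)]
    (hfree : ∀ g : G, g ≠ 1 →
      ∀ y : Metric.sphere (0 : EuclideanSpace ℝ (Fin (d + 2))) 1, g • y ≠ y)
    {f : EuclideanSpace ℝ (Fin (d + 1)) → Metric.sphere (0 : EuclideanSpace ℝ (Fin (d + 2))) 1}
    (hf : ContinuousOn f (Metric.closedBall 0 1))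
    (hequiv : ∀ (g : G) (x : Metric.sphere (0 : EuclideanSpace ℝ (Fin (d + 1))) 1),
      f (g • x : Metric.sphere (0 : EuclideanSpace ℝ (Fin (d + 1))) 1) = g • f x)
    (y : Metric.sphere (0 : EuclideanSpace ℝ (Fin (d + 2))) 1) :
    ∃ g : G, ∃ x ∈ Metric.closedBall (0 : EuclideanSpace ℝ (Fin (d + 1))) 1, f x = g • y := by
  by_contra! hmiss
  obtain ⟨Φ, hΦ, hΦeq⟩ := joinSpace.exists_equivariant_sphere (G := G) (N := d + 3) (n := d)
    (d + 1) (by omega) le_rfl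
  have hball : ∀ w, (Φ w : EuclideanSpace ℝ (Fin (d + 1))) ∈ Metric.closedBall 0 1 := fun w =>
    Metric.sphere_subset_closedBall (Φ w).2
  let i : Fin (d + 3) := ⟨d + 1, by omega⟩
  let j : Fin (d + 3) := ⟨d + 2, by omega⟩
  have hΦc : ContinuousOn (fun w => (Φ w : EuclideanSpace ℝ (Fin (d + 1))))
      (joinSpace G (d + 3) (d + 1)) := continuous_subtype_val.comp_continuousOn hΦ
  obtain ⟨F, hF, hFB, hFΦ⟩ := extendsInto_closedBall (joinCone G i) _ _ joinSpace.isClosed hΦc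
    fun w _ => hball w
  let Y : Set (Metric.sphere (0 : EuclideanSpace ℝ (Fin (d + 2))) 1) := {x | ∀ g : G, x ≠ g • y}
  have hY : ∀ g : G, ∀ x ∈ Y, g • x ∈ Y := fun g x hx k h =>
    hx (g⁻¹ * k) (by rw [mul_smul, ← h, inv_smul_smul])
  have hfY : MapsTo f (Metric.closedBall 0 1) Y := fun x hx g => hmiss g x hx
  obtain ⟨H, hH, hHeq, hHY⟩ := joinSpace.exists_equivariant_extension (i := i) hY
    (F := fun w => f (Φ w)) (F' := fun w => f (F w))
    (hf.comp hΦc fun w _ => hball w)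
    (fun g w hw => by rw [hΦeq g w hw, hequiv])
    (fun w _ => hfY (hball w))
    (hf.comp (hF.mono subset_union_right) (hFB.mono_left subset_union_right))
    (hfY.comp (hFB.mono_left subset_union_right))
    (fun w hw => congrArg f (hFΦ hw))
  have hHy : MapsTo H (joinSpace G (d + 3) j) {y}ᶜ := fun w hw h =>
    hHY hw 1 (by rw [one_smul]; exact h)
  obtain ⟨K, hK, -, hKH⟩ := extendsInto_compl_singleton_sphere (joinCone G j) y _ H
    joinSpace.isClosed hH hHy
  obtain ⟨Ψ, hΨ, hΨeq, -⟩ := joinSpace.exists_equivariant_extension (i := j)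
    (Y := univ) (fun _ _ _ => mem_univ _) hH hHeq (mapsTo_univ _ _)
    (hK.mono subset_union_right) (mapsTo_univ _ _) hKH
  exact not_exists_equivariant_joinSpace_sphere gen hfree hΨ hΨeq

end SphereMap

/-- Let a nontrivial finite group `G` act continuously and freely on `S^d` (the boundary of
the closed unit ball of `ℝ^{d+1}`) and on `S^{d+1}`.  If `f : ℝ^{d+1} → S^{d+1}` is
continuous on the closed unit ball and `G`-equivariant on the boundary sphere, then the image
of the closed unit ball under `f` meets every `G`-orbit of `S^{d+1}`. -/
theorem image_of_ball_meets_every_orbit (d : ℕ) (hd : 1 ≤ d)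
    (G : Type*) [Group G] [Finite G] [Nontrivial G] [TopologicalSpace G]
    [MulAction G (Metric.sphere (0 : EuclideanSpace ℝ (Fin (d + 1))) 1)]
    [ContinuousSMul G (Metric.sphere (0 : EuclideanSpace ℝ (Fin (d + 1))) 1)]
    [MulAction G (Metric.sphere (0 : EuclideanSpace ℝ (Fin (d + 2))) 1)]
    [ContinuousSMul G (Metric.sphere (0 : EuclideanSpace ℝ (Fin (d + 2))) 1)]
    (hfree_bd : ∀ g : G, g ≠ 1 →
      ∀ x : (Metric.sphere (0 : EuclideanSpace ℝ (Fin (d + 1))) 1), g • x ≠ x)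
    (hfree_tgt : ∀ g : G, g ≠ 1 →
      ∀ y : (Metric.sphere (0 : EuclideanSpace ℝ (Fin (d + 2))) 1), g • y ≠ y)
    (f : EuclideanSpace ℝ (Fin (d + 1)) →
      (Metric.sphere (0 : EuclideanSpace ℝ (Fin (d + 2))) 1))
    (hf : ContinuousOn f (Metric.closedBall 0 1))
    (hequiv : ∀ (g : G) (x : (Metric.sphere (0 : EuclideanSpace ℝ (Fin (d + 1))) 1)),
      f ↑(g • x) = g • f ↑x) :
    ∀ y : (Metric.sphere (0 : EuclideanSpace ℝ (Fin (d + 2))) 1),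
      ∃ g : G, ∃ x ∈ Metric.closedBall (0 : EuclideanSpace ℝ (Fin (d + 1))) 1,
        f x = g • y := by
  intro y
  obtain ⟨g, hg⟩ := exists_ne (1 : G)
  let H := Subgroup.zpowers g
  have : Fintype H := Fintype.ofFinite H
  have : Nontrivial H := (Subgroup.nontrivial_iff_ne_bot _).2 (by simpa [H] using hg)
  have gen : ∀ x : H, x ∈ Subgroup.zpowers (⟨g, Subgroup.mem_zpowers g⟩ : H) := by
    rintro ⟨x, k, rfl⟩
    exact ⟨k, Subtype.ext (by simp)⟩
  obtain ⟨h, x, hx, hxy⟩ := cyclic_image_of_ball_meets_orbit (G := H) gen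
    (fun k hk z => hfree_tgt k (by simpa using hk) z) hf (fun k x => hequiv k x) y
  exact ⟨h, x, hx, hxy⟩
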